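/- arXiv:1805.09530 — 4 statements merged into one kernel-verified Lean document; each statement's English description precedes it below -/
import Mathlib

section
/- Let (p^x) be a transition family for the G-lift, assume the support graph of the G-lift (the graph on S × G whose edges are pairs {(i,g), (j, g·σ i j)} with i ≠ j and q i j > 0) is connected, and assume H_t^i < ∞ for all i ∈ S and t ≥ 0. Then for every i ∈ S the limit lim_{t→∞} H_t^i/t exists; for every j ∈ S the limit lim_{t→∞} MI^j(X_1, X_t) exists; and for all i, j ∈ S, lim_{t→∞} H_t^i/t > 0 if and only if lim_{t→∞} MI^j(X_1, X_t) > 0. -/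
open Filter

noncomputable section

/-- Right-hand side of the master equation of the G-lift at state `x`. -/
def mEqDerivG {S : Type} [Fintype S] [DecidableEq S] {G : Type} [Group G]
    (q : S → S → ℝ) (σ : S → S → G)
    (f : S × G → ℝ) (x : S × G) : ℝ :=
  ∑ j ∈ Finset.univ.erase x.1,
    (f (j, x.2 * σ x.1 j) * q j x.1 - f x * q x.1 j)

/-- `p` is a solution of the master equation of the G-lift. -/
def IsMasterSolutionG {S : Type} [Fintype S] [DecidableEq S] {G : Type} [Group G]
    (q : S → S → ℝ) (σ : S → S → G) (p : ℝ → S × G → ℝ) : Prop :=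
  (∀ t : ℝ, 0 ≤ t → (∀ x, 0 ≤ p t x) ∧ (∑' x, p t x) = 1) ∧
  (∀ (x : S × G) (t : ℝ), 0 ≤ t →
    HasDerivWithinAt (fun s => p s x) (mEqDerivG q σ (p t) x) (Set.Ici 0) t)

/-- A transition family for the G-lift. -/
def IsTransitionFamilyG {S : Type} [Fintype S] [DecidableEq S] {G : Type} [Group G]
    (q : S → S → ℝ) (σ : S → S → G) (P : S × G → ℝ → S × G → ℝ) : Prop :=
  (∀ x, IsMasterSolutionG q σ (P x)) ∧
  (∀ x, P x 0 x = 1 ∧ ∀ y, y ≠ x → P x 0 y = 0) ∧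
  (∀ x z : S × G, ∀ s t : ℝ, 0 ≤ s → 0 ≤ t →
    P x (s + t) z = ∑' y, P x s y * P y t z)

/-- Entropy of a distribution on a countable set. -/
def Hent {X : Type*} (r : X → ℝ) : ℝ := ∑' x, Real.negMulLog (r x)

/-- Mutual information of a joint distribution on a product of countable sets. -/
def MI {Y Z : Type*} (ρ : Y × Z → ℝ) : ℝ :=
  ∑' yz : Y × Z,
    ρ yz * Real.log (ρ yz / ((∑' z, ρ (yz.1, z)) * ∑' y, ρ (y, yz.2)))

/-- Entropy with values in `ℝ≥0∞`. -/
def entropyENN {X : Type*} (r : X → ℝ) : ENNReal := ∑' x, ENNReal.ofReal (Real.negMulLog (r x))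

theorem ofReal_negMulLog {r : ℝ} (h0 : 0 ≤ r) :
    ENNReal.ofReal (Real.negMulLog r) = ENNReal.ofReal r * ENNReal.ofReal (-Real.log r) := by
  rw [← ENNReal.ofReal_mul h0]
  congr 1
  simp [Real.negMulLog]

theorem HasSum.tsum_ofReal {X : Type*} {f : X → ℝ} {a : ℝ} (h : HasSum f a) (h0 : ∀ x, 0 ≤ f x) :
    ∑' x, ENNReal.ofReal (f x) = ENNReal.ofReal a := by
  rw [← h.tsum_eq, ENNReal.ofReal_tsum_of_nonneg h0 h.summable]

theorem hasSum_of_tsum_ofReal {X : Type*} {f : X → ℝ} {a : ℝ} (h0 : ∀ x, 0 ≤ f x) (ha : 0 ≤ a)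
    (h : ∑' x, ENNReal.ofReal (f x) = ENNReal.ofReal a) : HasSum f a := by
  have h1 := ENNReal.hasSum_toReal (f := fun x => ENNReal.ofReal (f x)) (by rw [h]; simp)
  rw [← ENNReal.tsum_toReal_eq (by simp), h, ENNReal.toReal_ofReal ha] at h1
  simpa [ENNReal.toReal_ofReal, h0] using h1

theorem le_one_of_tsum_ofReal {X : Type*} {f : X → ℝ} (h : ∑' x, ENNReal.ofReal (f x) = 1)
    (x : X) : f x ≤ 1 :=
  ENNReal.ofReal_le_one.1 (h ▸ ENNReal.le_tsum (f := fun x => ENNReal.ofReal (f x)) x)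

/-- The pointwise inequality, a form of `log u + 1 ≤ u`, behind `entropyENN_submodular`. -/
theorem submod_pointwise {n k l p p' k' : ℝ} (hn : 0 ≤ n) (hk : 0 ≤ k) (hl : 0 ≤ l)
    (hk1 : k ≤ 1) (hp1 : p ≤ 1) (hp'1 : p' ≤ 1) (hk'1 : k' ≤ 1)
    (hp : n * k ≤ p) (hk' : k * l ≤ k') (hp' : n * k' ≤ p') :
    ENNReal.ofReal n * ENNReal.ofReal k * ENNReal.ofReal l * ENNReal.ofReal (-Real.log k)
      + ENNReal.ofReal n * ENNReal.ofReal k * ENNReal.ofReal l * ENNReal.ofReal (-Real.log p')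
      + ENNReal.ofReal n * ENNReal.ofReal k * ENNReal.ofReal l
    ≤ ENNReal.ofReal n * ENNReal.ofReal k * ENNReal.ofReal l * ENNReal.ofReal (-Real.log p)
      + ENNReal.ofReal n * ENNReal.ofReal k * ENNReal.ofReal l * ENNReal.ofReal (-Real.log k')
      + ENNReal.ofReal n * ENNReal.ofReal k' * (ENNReal.ofReal p')⁻¹ *
        (ENNReal.ofReal p * ENNReal.ofReal l) := by
  rcases hn.eq_or_lt with rfl | hn
  · simp
  rcases hk.eq_or_lt with rfl | hk
  · simp
  rcases hl.eq_or_lt with rfl | hl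
  · simp
  have hp0 : 0 < p := lt_of_lt_of_le (mul_pos hn hk) hp
  have hk'0 : 0 < k' := lt_of_lt_of_le (mul_pos hk hl) hk'
  have hp'0 : 0 < p' := lt_of_lt_of_le (mul_pos hn hk'0) hp'
  have lk : 0 ≤ -Real.log k := by have := Real.log_nonpos hk.le hk1; linarith
  have lp : 0 ≤ -Real.log p := by have := Real.log_nonpos hp0.le hp1; linarith
  have lp' : 0 ≤ -Real.log p' := by have := Real.log_nonpos hp'0.le hp'1; linarith
  have lk' : 0 ≤ -Real.log k' := by have := Real.log_nonpos hk'0.le hk'1; linarith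
  have ha : 0 ≤ n * k * l := (mul_pos (mul_pos hn hk) hl).le
  have hb : 0 ≤ n * k' * p'⁻¹ := (mul_pos (mul_pos hn hk'0) (inv_pos.2 hp'0)).le
  have hb' : 0 ≤ n * k' * p'⁻¹ * (p * l) := mul_nonneg hb (mul_pos hp0 hl).le
  rw [← ENNReal.ofReal_inv_of_pos hp'0, ← ENNReal.ofReal_mul hn.le,
    ← ENNReal.ofReal_mul (mul_pos hn hk).le, ← ENNReal.ofReal_mul hn.le,
    ← ENNReal.ofReal_mul (mul_pos hn hk'0).le, ← ENNReal.ofReal_mul hp0.le,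
    ← ENNReal.ofReal_mul hb]
  simp only [← ENNReal.ofReal_mul ha]
  rw [← ENNReal.ofReal_add (mul_nonneg ha lk) (mul_nonneg ha lp'),
    ← ENNReal.ofReal_add (add_nonneg (mul_nonneg ha lk) (mul_nonneg ha lp')) ha,
    ← ENNReal.ofReal_add (mul_nonneg ha lp) (mul_nonneg ha lk'),
    ← ENNReal.ofReal_add (add_nonneg (mul_nonneg ha lp) (mul_nonneg ha lk')) hb']
  apply ENNReal.ofReal_le_ofReal
  have key := Real.add_one_le_exp (Real.log p + Real.log k' - Real.log p' - Real.log k)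
  rw [Real.exp_sub, Real.exp_sub, Real.exp_add, Real.exp_log hp0, Real.exp_log hk'0,
    Real.exp_log hp'0, Real.exp_log hk] at key
  have h2 := mul_le_mul_of_nonneg_left key (mul_pos (mul_pos hn hk) hl).le
  have h3 : n * k * l * (p * k' / p' / k) = n * k' * p'⁻¹ * (p * l) := by
    field_simp
  rw [h3] at h2
  linarith

/-- The data processing inequality for a Markov chain `X → Y → Z`, in the form
`H(Y | X) + H(Z) ≤ H(Y) + H(Z | X)`. -/
theorem entropyENN_submodular {X Y Z : Type*} {ν : X → ℝ} {K : X → Y → ℝ} {L : Y → Z → ℝ}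
    {p : Y → ℝ} {K' : X → Z → ℝ} {p' : Z → ℝ}
    (hν0 : ∀ x, 0 ≤ ν x) (hK0 : ∀ x y, 0 ≤ K x y) (hL0 : ∀ y z, 0 ≤ L y z)
    (hν : HasSum ν 1) (hK : ∀ x, HasSum (K x) 1) (hL : ∀ y, HasSum (L y) 1)
    (hp : ∀ y, HasSum (fun x => ν x * K x y) (p y))
    (hK' : ∀ x z, HasSum (fun y => K x y * L y z) (K' x z))
    (hp' : ∀ z, HasSum (fun x => ν x * K' x z) (p' z)) :
    (∑' x, ENNReal.ofReal (ν x) * entropyENN (K x)) + entropyENN p' ≤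
      entropyENN p + ∑' x, ENNReal.ofReal (ν x) * entropyENN (K' x) := by
  have hp0 : ∀ y, 0 ≤ p y := fun y => (hp y).nonneg fun x => mul_nonneg (hν0 x) (hK0 x y)
  have hK'0 : ∀ x z, 0 ≤ K' x z :=
    fun x z => (hK' x z).nonneg fun y => mul_nonneg (hK0 x y) (hL0 y z)
  have hp'0 : ∀ z, 0 ≤ p' z := fun z => (hp' z).nonneg fun x => mul_nonneg (hν0 x) (hK'0 x z)
  have eν := hν.tsum_ofReal hν0
  have eK := fun x => (hK x).tsum_ofReal (hK0 x)
  have eL := fun y => (hL y).tsum_ofReal (hL0 y)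
  have ep := fun y => (hp y).tsum_ofReal (fun x => mul_nonneg (hν0 x) (hK0 x y))
  have eK' := fun x z => (hK' x z).tsum_ofReal (fun y => mul_nonneg (hK0 x y) (hL0 y z))
  have ep' := fun z => (hp' z).tsum_ofReal (fun x => mul_nonneg (hν0 x) (hK'0 x z))
  simp only [ENNReal.ofReal_mul, hν0, hK0, ENNReal.ofReal_one] at eν eK eL ep eK' ep'
  have eK'1 : ∀ x, ∑' z, ENNReal.ofReal (K' x z) = 1 := by
    intro x
    simp_rw [← eK' x]
    rw [ENNReal.tsum_comm]
    simp [ENNReal.tsum_mul_left, eL, eK]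
  have ep1 : ∑' y, ENNReal.ofReal (p y) = 1 := by
    simp_rw [← ep]
    rw [ENNReal.tsum_comm]
    simp [ENNReal.tsum_mul_left, eK, eν]
  have ep'2 : ∀ z, ∑' y, ENNReal.ofReal (p y) * ENNReal.ofReal (L y z) = ENNReal.ofReal (p' z) := by
    intro z
    simp_rw [← ep, ← ep', ← eK', ← ENNReal.tsum_mul_right, ← ENNReal.tsum_mul_left]
    rw [ENNReal.tsum_comm]
    simp only [mul_assoc]
  have ep'1 : ∑' z, ENNReal.ofReal (p' z) = 1 := by
    simp_rw [← ep']
    rw [ENNReal.tsum_comm]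
    simp [ENNReal.tsum_mul_left, eK'1, eν]
  have pw : ∀ x y z, _ := fun x y z => submod_pointwise (hν0 x) (hK0 x y) (hL0 y z)
    (le_one_of_tsum_ofReal (eK x) y) (le_one_of_tsum_ofReal ep1 y) (le_one_of_tsum_ofReal ep'1 z) (le_one_of_tsum_ofReal (eK'1 x) z)
    (le_hasSum (hp y) x fun i _ => mul_nonneg (hν0 i) (hK0 i y))
    (le_hasSum (hK' x z) y fun i _ => mul_nonneg (hK0 x i) (hL0 i z))
    (le_hasSum (hp' z) x fun i _ => mul_nonneg (hν0 i) (hK'0 i z))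
  have sm := ENNReal.tsum_le_tsum fun x => ENNReal.tsum_le_tsum fun y =>
    ENNReal.tsum_le_tsum fun z => pw x y z
  simp only [ENNReal.tsum_add] at sm
  have t1 : ∑' x, ∑' y, ∑' z, ENNReal.ofReal (ν x) * ENNReal.ofReal (K x y) *
      ENNReal.ofReal (L y z) * ENNReal.ofReal (-Real.log (K x y)) =
      ∑' x, ENNReal.ofReal (ν x) * entropyENN (K x) := by
    simp only [entropyENN, ofReal_negMulLog, hK0, ENNReal.tsum_mul_right, ENNReal.tsum_mul_left,
      eL, one_mul, mul_assoc]
  have t2 : ∑' x, ∑' y, ∑' z, ENNReal.ofReal (ν x) * ENNReal.ofReal (K x y) *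
      ENNReal.ofReal (L y z) * ENNReal.ofReal (-Real.log (p' z)) = entropyENN p' := by
    simp only [entropyENN, ofReal_negMulLog, hp'0]
    rw [tsum_congr (fun x => ENNReal.tsum_comm), ENNReal.tsum_comm]
    refine tsum_congr fun z => ?_
    simp only [mul_assoc, ENNReal.tsum_mul_left]
    simp only [← mul_assoc, ENNReal.tsum_mul_right, eK', ep']
  have t3 : ∑' x, ∑' y, ∑' z, ENNReal.ofReal (ν x) * ENNReal.ofReal (K x y) *
      ENNReal.ofReal (L y z) = 1 := by
    simp [ENNReal.tsum_mul_left, eL, eK, eν]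
  have t4 : ∑' x, ∑' y, ∑' z, ENNReal.ofReal (ν x) * ENNReal.ofReal (K x y) *
      ENNReal.ofReal (L y z) * ENNReal.ofReal (-Real.log (p y)) = entropyENN p := by
    simp only [entropyENN, ofReal_negMulLog, hp0]
    rw [ENNReal.tsum_comm]
    simp only [ENNReal.tsum_mul_right, ENNReal.tsum_mul_left, eL, mul_one, ep]
  have t5 : ∑' x, ∑' y, ∑' z, ENNReal.ofReal (ν x) * ENNReal.ofReal (K x y) *
      ENNReal.ofReal (L y z) * ENNReal.ofReal (-Real.log (K' x z)) =
      ∑' x, ENNReal.ofReal (ν x) * entropyENN (K' x) := by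
    simp only [entropyENN, ofReal_negMulLog, hK'0]
    refine tsum_congr fun x => ?_
    rw [ENNReal.tsum_comm, ← ENNReal.tsum_mul_left]
    refine tsum_congr fun z => ?_
    simp only [mul_assoc, ENNReal.tsum_mul_left]
    simp only [← mul_assoc, ENNReal.tsum_mul_right, eK']
  have t6 : ∑' x, ∑' y, ∑' z, ENNReal.ofReal (ν x) * ENNReal.ofReal (K' x z) *
      (ENNReal.ofReal (p' z))⁻¹ * (ENNReal.ofReal (p y) * ENNReal.ofReal (L y z)) ≤ 1 := by
    calc _ ≤ ∑' x, ENNReal.ofReal (ν x) := by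
            refine ENNReal.tsum_le_tsum fun x => ?_
            rw [ENNReal.tsum_comm]
            calc _ ≤ ∑' z, ENNReal.ofReal (ν x) * ENNReal.ofReal (K' x z) := by
                  refine ENNReal.tsum_le_tsum fun z => ?_
                  rw [ENNReal.tsum_mul_left, ep'2, mul_assoc]
                  exact mul_le_of_le_one_right' (by
                    rw [mul_comm, ← div_eq_mul_inv]; exact ENNReal.div_self_le_one)
              _ = _ := by rw [ENNReal.tsum_mul_left, eK'1, mul_one]
      _ = 1 := eν
  rw [t1, t2, t3, t4, t5] at sm
  exact ENNReal.le_of_add_le_add_right ENNReal.one_ne_top (sm.trans (add_le_add le_rfl t6))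

/-- A stochastic matrix with positive entries has a positive stationary distribution. -/
theorem exists_stationary_of_pos {S : Type*} [Fintype S] [DecidableEq S] [Nonempty S]
    (A : S → S → ℝ) (hpos : ∀ i k, 0 < A i k) (hsum : ∀ i, ∑ k, A i k = 1) :
    ∃ w : S → ℝ, (∀ i, 0 < w i) ∧ ∑ i, w i = 1 ∧ ∀ k, ∑ i, w i * A i k = w k := by
  have hdet : (Matrix.of A - 1).det = 0 := by
    rw [← Matrix.exists_mulVec_eq_zero_iff]
    refine ⟨fun _ => 1, fun h => ?_, ?_⟩
    · simpa using congrFun h (Classical.arbitrary S)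
    · ext i
      simp [Matrix.mulVec, dotProduct, hsum, Matrix.one_apply]
  obtain ⟨v, hv0, hv⟩ := Matrix.exists_vecMul_eq_zero_iff.2 hdet
  have hv' : ∀ k, ∑ i, v i * A i k = v k := by
    intro k
    have := congrFun hv k
    rw [Matrix.vecMul_sub, Matrix.vecMul_one] at this
    simp only [Pi.sub_apply, Pi.zero_apply, Matrix.vecMul, dotProduct, Matrix.of_apply] at this
    linarith
  have hle : ∀ k ∈ Finset.univ, |v k| ≤ ∑ i, |v i| * A i k := by
    intro k _
    calc |v k| = |∑ i, v i * A i k| := by rw [hv']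
      _ ≤ ∑ i, |v i * A i k| := Finset.abs_sum_le_sum_abs _ _
      _ = _ := by simp [abs_mul, abs_of_pos (hpos _ _)]
  have htot : ∑ k, |v k| = ∑ k, ∑ i, |v i| * A i k := by
    rw [Finset.sum_comm]
    simp [← Finset.mul_sum, hsum]
  have heq := (Finset.sum_eq_sum_iff_of_le hle).1 htot
  obtain ⟨i0, hi0⟩ := Function.ne_iff.1 hv0
  have hi0 : 0 < |v i0| := abs_pos.2 hi0
  have hvpos : ∀ k, 0 < |v k| := by
    intro k
    rw [heq k (Finset.mem_univ k)]
    exact Finset.sum_pos' (fun i _ => mul_nonneg (abs_nonneg _) (hpos i k).le)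
      ⟨i0, Finset.mem_univ _, mul_pos hi0 (hpos _ _)⟩
  have hV : 0 < ∑ k, |v k| := Finset.sum_pos (fun k _ => hvpos k) Finset.univ_nonempty
  refine ⟨fun i => |v i| / ∑ k, |v k|, fun i => div_pos (hvpos i) hV, ?_, fun k => ?_⟩
  · rw [← Finset.sum_div, div_self hV.ne']
  · simp only [div_mul_eq_mul_div, ← Finset.sum_div]
    rw [← heq k (Finset.mem_univ k)]

/-- A stochastic matrix with entries at least `ε` contracts oscillations by `1 - ε`. -/
theorem osc_contract {S : Type*} [Fintype S] [Nonempty S]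
    (A : S → S → ℝ) {ε : ℝ} (hε : ∀ i k, ε ≤ A i k) (hA : ∀ i k, 0 ≤ A i k)
    (hsum : ∀ i, ∑ k, A i k = 1)
    (h : S → ℝ) {D : ℝ} (hD : ∀ i j, h i - h j ≤ D) (i j : S) :
    ∑ k, A i k * h k - ∑ k, A j k * h k ≤ (1 - ε) * D := by
  classical
  have hD0 : 0 ≤ D := by simpa using hD i i
  obtain ⟨k0, hk0⟩ := Finite.exists_min h
  have h1 : ∑ k, A i k * h k ≤ ∑ k, (A i k * (h k0 + D) - if k = k0 then A i k * D else 0) := by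
    refine Finset.sum_le_sum fun k _ => ?_
    split_ifs with hk
    · subst hk; linarith
    · have := mul_le_mul_of_nonneg_left (hD k k0) (hA i k)
      linarith
  have h2 : ∑ k, A j k * h k0 ≤ ∑ k, A j k * h k :=
    Finset.sum_le_sum fun k _ => mul_le_mul_of_nonneg_left (hk0 k) (hA j k)
  rw [Finset.sum_sub_distrib, ← Finset.sum_mul, hsum, Finset.sum_ite_eq' Finset.univ k0] at h1
  rw [← Finset.sum_mul, hsum] at h2
  simp only [Finset.mem_univ, if_true] at h1
  have := mul_le_mul_of_nonneg_right (hε i k0) hD0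
  linarith

theorem tendsto_of_antitone_nonneg {d : ℝ → ℝ} {a : ℝ} (h0 : ∀ t, a ≤ t → 0 ≤ d t)
    (hd : ∀ t t', a ≤ t → t ≤ t' → d t' ≤ d t) : ∃ M, 0 ≤ M ∧ Tendsto d atTop (nhds M) := by
  have hanti : Antitone fun t => d (max a t) := fun t t' h =>
    hd _ _ (le_max_left _ _) (max_le_max le_rfl h)
  have hbdd : BddBelow (Set.range fun t => d (max a t)) :=
    ⟨0, by rintro _ ⟨t, rfl⟩; exact h0 _ (le_max_left _ _)⟩
  have ht := tendsto_atTop_ciInf hanti hbdd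
  refine ⟨_, le_ciInf fun t => h0 _ (le_max_left _ _), ht.congr' ?_⟩
  filter_upwards [eventually_ge_atTop a] with t hta
  rw [max_eq_right hta]

/-- Vector-valued growth: entropies `H` whose one-step defects against a stochastic semigroup `A`
are nonnegative and nonincreasing. -/
theorem growth_limits {S : Type*} [Fintype S] [DecidableEq S] [Nonempty S]
    (H : ℝ → S → ℝ) (A : ℝ → S → S → ℝ) (c : ℝ)
    (H0 : ∀ i, H 0 i = 0) (Hnn : ∀ t i, 0 ≤ t → 0 ≤ H t i)
    (Ann : ∀ s i k, 0 ≤ s → 0 ≤ A s i k)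
    (Apos : ∀ s i k, 0 < s → 0 < A s i k) (Asum : ∀ s i, 0 ≤ s → ∑ k, A s i k = 1)
    (Asemi : ∀ s t i k, 0 ≤ s → 0 ≤ t → A (s + t) i k = ∑ l, A s i l * A t l k)
    (hc : 0 < c) (Ac : ∀ s i, 0 ≤ s → s ≤ 1 → c ≤ A s i i)
    (Dnn : ∀ s t i, 0 ≤ s → s ≤ t → 0 ≤ H t i - ∑ k, A s i k * H (t - s) k)
    (Dmono : ∀ s t t' i, 0 ≤ s → s ≤ t → t ≤ t' →
      H t' i - ∑ k, A s i k * H (t' - s) k ≤ H t i - ∑ k, A s i k * H (t - s) k) :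
    ∃ (L : ℝ) (M : S → ℝ), (∀ i, Tendsto (fun t => H t i / t) atTop (nhds L)) ∧
      (∀ j, Tendsto (fun t => H t j - ∑ k, A 1 j k * H (t - 1) k) atTop (nhds (M j))) ∧
      ∀ j, 0 < L ↔ 0 < M j := by
  have hlim : ∀ s, 0 ≤ s → ∀ i, ∃ M, 0 ≤ M ∧
      Tendsto (fun t => H t i - ∑ k, A s i k * H (t - s) k) atTop (nhds M) := fun s hs i =>
    tendsto_of_antitone_nonneg (fun t ht => Dnn s t i hs ht)
      (fun t t' ht htt' => Dmono s t t' i hs ht htt')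
  choose M hM0 hM using hlim 1 zero_le_one
  choose N hN0 hN using hlim (1 / 2) (by norm_num)
  have hMN : ∀ i, M i = N i + ∑ k, A (1 / 2) i k * N k := by
    intro i
    have hs : Tendsto (fun t : ℝ => t - 1 / 2) atTop atTop :=
      tendsto_atTop_add_const_right _ _ tendsto_id
    have h1 := (hN i).add (tendsto_finsetSum Finset.univ fun k _ =>
      ((hN k).comp hs).const_mul (A (1 / 2) i k))
    refine tendsto_nhds_unique (hM i) (h1.congr fun t => ?_)
    have hA : ∀ k, A 1 i k = ∑ l, A (1 / 2) i l * A (1 / 2) l k := by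
      intro k
      rw [← Asemi _ _ _ _ (by norm_num) (by norm_num)]
      norm_num
    have e : t - 1 / 2 - 1 / 2 = t - 1 := by ring
    simp only [hA, Function.comp, mul_sub, Finset.sum_sub_distrib, Finset.mul_sum, Finset.sum_mul,
      e]
    rw [Finset.sum_comm (γ := S)]
    simp only [mul_assoc]
    ring
  obtain ⟨w, hw, hw1, hwA⟩ := exists_stationary_of_pos (A 1) (fun i k => Apos 1 i k one_pos)
    (fun i => Asum 1 i zero_le_one)
  obtain ⟨ε, hε, hεA⟩ : ∃ ε, 0 < ε ∧ ∀ i k, ε ≤ A 1 i k := by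
    obtain ⟨x, hx⟩ := Finite.exists_min (fun x : S × S => A 1 x.1 x.2)
    exact ⟨_, Apos 1 x.1 x.2 one_pos, fun i k => hx (i, k)⟩
  obtain ⟨B, hB⟩ : ∃ B, ∀ i, H 1 i ≤ B := by
    obtain ⟨x, hx⟩ := Finite.exists_max (H 1)
    exact ⟨_, hx⟩
  have hB0 : 0 ≤ B := (Hnn 1 (Classical.arbitrary S) zero_le_one).trans (hB _)
  have hinit : ∀ r i, 0 ≤ r → r ≤ 1 → H r i ≤ B / c := by
    intro r i h0 h1
    have h2 := Dnn (1 - r) 1 i (by linarith) (by linarith)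
    rw [sub_sub_cancel] at h2
    have h3 := Finset.single_le_sum (f := fun k => A (1 - r) i k * H r k)
      (fun k _ => mul_nonneg (Ann _ _ _ (by linarith)) (Hnn _ _ h0)) (Finset.mem_univ i)
    have h4 := mul_le_mul_of_nonneg_right (Ac (1 - r) i (by linarith) (by linarith)) (Hnn r i h0)
    rw [le_div_iff₀ hc]
    have h5 := hB i
    nlinarith
  have hD1 : ∀ t i, 1 ≤ t → H t i - ∑ k, A 1 i k * H (t - 1) k ≤ B := by
    intro t i ht
    refine (Dmono 1 1 t i zero_le_one le_rfl ht).trans ?_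
    simpa [H0] using hB i
  obtain ⟨K, hK1, hK2⟩ : ∃ K, B / c ≤ K ∧ B / ε ≤ K := ⟨_, le_max_left _ _, le_max_right _ _⟩
  have hosc : ∀ n : ℕ, ∀ t : ℝ, 0 ≤ t → t ≤ n + 1 → ∀ i j, H t i - H t j ≤ K := by
    intro n
    induction n with
    | zero =>
      intro t h0 h1 i j
      have := hinit t i h0 (by simpa using h1)
      have := Hnn t j h0
      linarith
    | succ n ih =>
      intro t h0 h1 i j
      by_cases ht : t ≤ 1
      · have := hinit t i h0 ht
        have := Hnn t j h0
        linarith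
      push Not at ht
      push_cast at h1
      have h2 := osc_contract (A 1) hεA (fun i k => Ann 1 i k zero_le_one)
        (fun i => Asum 1 i zero_le_one) (H (t - 1))
        (ih (t - 1) (by linarith) (by linarith)) i j
      have h3 := hD1 t i ht.le
      have h4 := Dnn 1 t j zero_le_one ht.le
      have h5 : B ≤ K * ε := (div_le_iff₀ hε).1 hK2
      linarith
  have hosc' : ∀ t, 0 ≤ t → ∀ i j, H t i - H t j ≤ K := fun t ht i j =>
    hosc ⌈t⌉₊ t ht ((Nat.le_ceil t).trans (by linarith)) i j
  have hmono : ∀ s t i, 0 ≤ s → s ≤ t → H s i - K ≤ H t i := by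
    intro s t i h0 hst
    have h1 := Dnn (t - s) t i (by linarith) (by linarith)
    rw [sub_sub_cancel] at h1
    have h2 : ∑ k, A (t - s) i k * (H s i - K) ≤ ∑ k, A (t - s) i k * H s k := by
      refine Finset.sum_le_sum fun k _ => mul_le_mul_of_nonneg_left ?_ (Ann _ _ _ (by linarith))
      have := hosc' s h0 i k
      linarith
    rw [← Finset.sum_mul, Asum _ _ (by linarith)] at h2
    linarith
  set Mb := ∑ j, w j * M j with hMb
  have hf : Tendsto (fun n : ℕ => ∑ i, w i * H ((n + 1 : ℕ) : ℝ) i - ∑ i, w i * H (n : ℝ) i)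
      atTop (nhds Mb) := by
    have h1 : Tendsto (fun n : ℕ => ((n + 1 : ℕ) : ℝ)) atTop atTop :=
      tendsto_natCast_atTop_atTop.comp (tendsto_add_atTop_nat 1)
    refine (tendsto_finsetSum Finset.univ fun j _ =>
      ((hM j).comp h1).const_mul (w j)).congr fun n => ?_
    simp only [Function.comp, Nat.cast_add, Nat.cast_one, add_sub_cancel_right, mul_sub,
      Finset.sum_sub_distrib, Finset.mul_sum]
    congr 1
    rw [Finset.sum_comm]
    refine Finset.sum_congr rfl fun k _ => ?_
    rw [← hwA k, Finset.sum_mul]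
    simp only [mul_assoc]
  have hcesaro : Tendsto (fun n : ℕ => (∑ i, w i * H (n : ℝ) i) / n) atTop (nhds Mb) := by
    refine hf.cesaro.congr fun n => ?_
    rw [Finset.sum_range_sub (fun n : ℕ => ∑ i, w i * H (n : ℝ) i)]
    simp [H0, div_eq_inv_mul]
  have hreal : Tendsto (fun t : ℝ => (∑ i, w i * H (⌊t⌋₊ : ℝ) i) / t) atTop (nhds Mb) := by
    have h1 := (hcesaro.comp tendsto_nat_floor_atTop (α := ℝ)).mul
      (tendsto_nat_floor_div_atTop (R := ℝ))
    rw [mul_one] at h1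
    refine h1.congr' ?_
    filter_upwards [eventually_ge_atTop 1] with t ht
    have : (⌊t⌋₊ : ℝ) ≠ 0 := by
      have := Nat.floor_pos.2 ht
      positivity
    simp only [Function.comp]
    field_simp
  have hclose : ∀ t i, 0 ≤ t → |H t i - ∑ k, w k * H (⌊t⌋₊ : ℝ) k| ≤ 3 * K + B := by
    intro t i ht
    have hn := Nat.floor_le ht
    have hn1 := (Nat.lt_floor_add_one t).le
    set n := ⌊t⌋₊
    have hlow := hmono n t i (by positivity) hn
    have hup := hmono t (n + 1) i ht hn1
    have hstep := hD1 (n + 1) i (by have : (0 : ℝ) ≤ n := by positivity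
                                    linarith)
    rw [add_sub_cancel_right] at hstep
    have hA : ∑ k, A 1 i k * H n k ≤ ∑ k, A 1 i k * (H n i + K) :=
      Finset.sum_le_sum fun k _ => mul_le_mul_of_nonneg_left
        (by have := hosc' n (by positivity) k i; linarith) (Ann _ _ _ zero_le_one)
    have hw2 : ∑ k, w k * H n k ≤ ∑ k, w k * (H n i + K) :=
      Finset.sum_le_sum fun k _ => mul_le_mul_of_nonneg_left
        (by have := hosc' n (by positivity) k i; linarith) (hw k).le
    have hw3 : ∑ k, w k * (H n i - K) ≤ ∑ k, w k * H n k :=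
      Finset.sum_le_sum fun k _ => mul_le_mul_of_nonneg_left
        (by have := hosc' n (by positivity) i k; linarith) (hw k).le
    rw [← Finset.sum_mul, Asum _ _ zero_le_one] at hA
    rw [← Finset.sum_mul, hw1] at hw2 hw3
    rw [abs_le]
    have hK0 := hosc' t ht i i
    rw [sub_self] at hK0
    constructor <;> linarith
  refine ⟨Mb, M, fun i => ?_, hM, fun j => ?_⟩
  · have hz : Tendsto (fun t : ℝ => (H t i - ∑ k, w k * H (⌊t⌋₊ : ℝ) k) / t) atTop (nhds 0) := by
      refine squeeze_zero_norm' ?_ ((tendsto_const_nhds (x := 3 * K + B)).div_atTop tendsto_id)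
      filter_upwards [eventually_gt_atTop 0] with t ht
      rw [norm_div, Real.norm_eq_abs, Real.norm_eq_abs, abs_of_pos ht]
      exact div_le_div_of_nonneg_right (hclose t i ht.le) ht.le
    have := hz.add hreal
    rw [zero_add] at this
    exact this.congr fun t => by ring
  · constructor
    · intro hL
      by_contra hj
      have hj0 : M j = 0 := le_antisymm (not_lt.1 hj) (hM0 j)
      have hterm : ∀ i k, 0 ≤ A (1 / 2) i k * N k := fun i k =>
        mul_nonneg (Ann _ _ _ (by norm_num)) (hN0 k)
      have hN' : ∀ k, N k = 0 := by
        have h1 := hMN j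
        have h2 := hN0 j
        have h3 := Finset.sum_nonneg fun k (_ : k ∈ Finset.univ) => hterm j k
        have h4 : ∑ k, A (1 / 2) j k * N k = 0 := by linarith
        intro k
        have := (Finset.sum_eq_zero_iff_of_nonneg fun k _ => hterm j k).1 h4 k (Finset.mem_univ k)
        exact (mul_eq_zero.1 this).resolve_left (Apos _ _ _ (by norm_num)).ne'
      have : Mb = 0 := by simp [hMb, hMN, hN']
      linarith
    · intro hj
      exact Finset.sum_pos' (fun i _ => mul_nonneg (hw i).le (hM0 i))
        ⟨j, Finset.mem_univ _, mul_pos (hw j) hj⟩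
section Lift

variable {S : Type} [Fintype S] [DecidableEq S] {G : Type} [Group G]
  {q : S → S → ℝ} {σ : S → S → G}

theorem mEqDerivG_sub (f g : S × G → ℝ) (x : S × G) :
    mEqDerivG q σ (fun z => f z - g z) x = mEqDerivG q σ f x - mEqDerivG q σ g x := by
  simp only [mEqDerivG, ← Finset.sum_sub_distrib]
  exact Finset.sum_congr rfl fun j _ => by ring

/-- A bound for the total transition rates. -/
def rateBound (q : S → S → ℝ) : ℝ := ∑ i, ∑ j, (|q j i| + |q i j|)

theorem sum_erase_le_rateBound (i : S) :
    ∑ j ∈ Finset.univ.erase i, (|q j i| + |q i j|) ≤ rateBound q := by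
  have h0 : ∀ i j : S, 0 ≤ |q j i| + |q i j| := fun i j => by positivity
  refine (Finset.sum_le_sum_of_subset_of_nonneg (Finset.subset_univ _)
    fun j _ _ => h0 i j).trans ?_
  exact Finset.single_le_sum (f := fun i => ∑ j, (|q j i| + |q i j|))
    (fun i _ => Finset.sum_nonneg fun j _ => h0 i j) (Finset.mem_univ i)

theorem abs_mEqDerivG_le {f : S × G → ℝ} {b : ℝ} (hf : ∀ z, |f z| ≤ b) (x : S × G) :
    |mEqDerivG q σ f x| ≤ rateBound q * b := by
  have hb : 0 ≤ b := (abs_nonneg _).trans (hf x)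
  refine (Finset.abs_sum_le_sum_abs _ _).trans ?_
  refine le_trans ?_ (mul_le_mul_of_nonneg_right (sum_erase_le_rateBound x.1) hb)
  rw [Finset.sum_mul]
  refine Finset.sum_le_sum fun j _ => (abs_sub _ _).trans ?_
  rw [abs_mul, abs_mul, add_mul, mul_comm |q j x.1|, mul_comm |q x.1 j|]
  exact add_le_add (mul_le_mul_of_nonneg_right (hf _) (abs_nonneg _))
    (mul_le_mul_of_nonneg_right (hf _) (abs_nonneg _))

theorem neg_rateBound_mul_le {f : S × G → ℝ} (hq : ∀ i j : S, i ≠ j → 0 ≤ q i j)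
    (hf : ∀ z, 0 ≤ f z) (x : S × G) : -(rateBound q * f x) ≤ mEqDerivG q σ f x := by
  have h := mul_le_mul_of_nonneg_right (sum_erase_le_rateBound (q := q) x.1) (hf x)
  refine (neg_le_neg h).trans ?_
  rw [Finset.sum_mul, ← Finset.sum_neg_distrib]
  refine Finset.sum_le_sum fun j hj => ?_
  have h1 := hq j x.1 (Finset.ne_of_mem_erase hj)
  have h2 := mul_nonneg (hf (j, x.2 * σ x.1 j)) h1
  have h3 := mul_nonneg (hf x) (abs_nonneg (q j x.1))
  have h4 := mul_le_mul_of_nonneg_left (le_abs_self (q x.1 j)) (hf x)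
  linarith

namespace IsMasterSolutionG

variable {p p' : ℝ → S × G → ℝ}

theorem hasSum (h : IsMasterSolutionG q σ p) {t : ℝ} (ht : 0 ≤ t) : HasSum (p t) 1 := by
  have h1 := (h.1 t ht).2
  by_cases hs : Summable (p t)
  · rw [← h1]; exact hs.hasSum
  · rw [tsum_eq_zero_of_not_summable hs] at h1
    exact absurd h1 zero_ne_one

theorem le_one (h : IsMasterSolutionG q σ p) {t : ℝ} (ht : 0 ≤ t) (x : S × G) : p t x ≤ 1 :=
  le_hasSum (h.hasSum ht) x fun i _ => (h.1 t ht).1 i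

theorem unique (h : IsMasterSolutionG q σ p) (h' : IsMasterSolutionG q σ p') (h0 : p 0 = p' 0)
    {t : ℝ} (ht : 0 ≤ t) (x : S × G) : p t x = p' t x := by
  set C := rateBound q
  have key : ∀ n : ℕ, ∀ t, 0 ≤ t → ∀ x, |p t x - p' t x| ≤ (C * t) ^ n / n.factorial := by
    intro n
    induction n with
    | zero =>
      intro t ht x
      have := (h.1 t ht).1 x
      have := (h'.1 t ht).1 x
      have := h.le_one ht x
      have := h'.le_one ht x
      rw [abs_le]
      simp only [pow_zero, Nat.factorial_zero, Nat.cast_one, div_one]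
      constructor <;> linarith
    | succ n ih =>
      intro t ht x
      have hd : ∀ s, 0 ≤ s → HasDerivWithinAt (fun s => p s x - p' s x)
          (mEqDerivG q σ (fun z => p s z - p' s z) x) (Set.Ici 0) s := by
        intro s hs
        rw [mEqDerivG_sub]
        exact (h.2 x s hs).sub (h'.2 x s hs)
      refine image_norm_le_of_norm_deriv_right_le_deriv_boundary (a := 0) (b := t)
        (f := fun s => p s x - p' s x)
        (f' := fun s => mEqDerivG q σ (fun z => p s z - p' s z) x)
        (B := fun s => (C * s) ^ (n + 1) / (n + 1).factorial)
        (B' := fun s => C * ((C * s) ^ n / n.factorial))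
        (fun s hs => ((hd s hs.1).continuousWithinAt).mono Set.Icc_subset_Ici_self)
        (fun s hs => (hd s hs.1).mono (Set.Ici_subset_Ici.2 hs.1)) ?_ ?_ ?_ ⟨ht, le_rfl⟩
      · simp [h0]
      · intro s
        have := (((hasDerivAt_id s).const_mul C).pow (n + 1)).div_const ((n + 1).factorial : ℝ)
        refine this.congr_deriv ?_
        have : ((n : ℝ) + 1) ≠ 0 := by positivity
        have : (n.factorial : ℝ) ≠ 0 := by positivity
        simp only [Nat.factorial_succ, Nat.cast_mul, Nat.cast_add, Nat.cast_one,
          add_tsub_cancel_right, mul_one, id]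
        field_simp
      · intro s hs
        exact abs_mEqDerivG_le (ih s hs.1) x
  have hlim := ge_of_tendsto' (FloorSemiring.tendsto_pow_div_factorial_atTop (C * t))
    fun n => key n t ht x
  exact sub_eq_zero.1 (abs_nonpos_iff.1 hlim)

theorem translate (h : IsMasterSolutionG q σ p) (g : G) :
    IsMasterSolutionG q σ fun t z => p t (z.1, g * z.2) := by
  refine ⟨fun t ht => ⟨fun x => (h.1 t ht).1 _, ?_⟩, fun x t ht => ?_⟩
  · rw [← (h.1 t ht).2]
    exact ((Equiv.refl S).prodCongr (Equiv.mulLeft g)).tsum_eq (p t)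
  · have := h.2 (x.1, g * x.2) t ht
    simpa only [mEqDerivG, mul_assoc] using this

theorem monotoneOn_exp_mul (h : IsMasterSolutionG q σ p) (hq : ∀ i j : S, i ≠ j → 0 ≤ q i j)
    (x : S × G) : MonotoneOn (fun t => Real.exp (rateBound q * t) * p t x) (Set.Ici 0) := by
  have hd : ∀ t, 0 ≤ t → HasDerivWithinAt (fun t => Real.exp (rateBound q * t) * p t x)
      (Real.exp (rateBound q * t) * (rateBound q * p t x + mEqDerivG q σ (p t) x))
      (Set.Ici 0) t := by
    intro t ht
    have h1 := ((hasDerivAt_id t).const_mul (rateBound q)).exp.hasDerivWithinAt (s := Set.Ici 0)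
    refine (h1.mul (h.2 x t ht)).congr_deriv ?_
    simp only [id, mul_one]
    ring
  refine monotoneOn_of_hasDerivWithinAt_nonneg (convex_Ici 0)
    (fun t ht => (hd t ht).continuousWithinAt)
    (fun t ht => (hd t (interior_subset ht)).mono interior_subset) fun t ht => ?_
  have h1 := neg_rateBound_mul_le (σ := σ) hq (h.1 t (interior_subset ht)).1 x
  exact mul_nonneg (Real.exp_nonneg _) (by linarith)

theorem pos_of_edge (h : IsMasterSolutionG q σ p) (hq : ∀ i j : S, i ≠ j → 0 ≤ q i j)
    (hσ : ∀ i j, σ j i = (σ i j)⁻¹) {a b : S × G}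
    (hab : a.1 ≠ b.1 ∧ 0 < q a.1 b.1 ∧ b.2 = a.2 * σ a.1 b.1)
    (ha : ∀ t, 0 < t → 0 < p t a) (t : ℝ) (ht : 0 < t) : 0 < p t b := by
  by_contra hb
  have hbt : p t b = 0 := le_antisymm (not_lt.1 hb) ((h.1 t ht.le).1 b)
  have hz : ∀ s, 0 ≤ s → s ≤ t → p s b = 0 := by
    intro s hs hst
    have h1 := h.monotoneOn_exp_mul hq b hs ht.le hst
    simp only [hbt, mul_zero] at h1
    exact le_antisymm (nonpos_of_mul_nonpos_right h1 (Real.exp_pos _)) ((h.1 s hs).1 b)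
  have h2 : 0 ≤ t / 2 := by linarith
  have hd : HasDerivAt (fun s => p s b) (mEqDerivG q σ (p (t / 2)) b) (t / 2) :=
    (h.2 b (t / 2) h2).hasDerivAt (Ici_mem_nhds (by linarith))
  have hd0 : HasDerivAt (fun s => p s b) 0 (t / 2) := by
    refine (hasDerivAt_const (t / 2) (0 : ℝ)).congr_of_eventuallyEq ?_
    filter_upwards [Icc_mem_nhds (show (0 : ℝ) < t / 2 by linarith)
      (show t / 2 < t by linarith)] with s hs
    exact hz s hs.1 hs.2
  have he := hd.unique hd0
  have hpos : 0 < mEqDerivG q σ (p (t / 2)) b := by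
    simp only [mEqDerivG, hz (t / 2) h2 (by linarith), zero_mul, sub_zero]
    refine Finset.sum_pos' (fun j hj => mul_nonneg ((h.1 _ h2).1 _)
      (hq j b.1 (Finset.ne_of_mem_erase hj))) ⟨a.1, ?_, ?_⟩
    · exact Finset.mem_erase.2 ⟨hab.1, Finset.mem_univ _⟩
    · have : (a.1, b.2 * σ b.1 a.1) = a := by
        rw [hab.2.2, hσ a.1 b.1, mul_inv_cancel_right]
      rw [this]
      exact mul_pos (ha _ (by linarith)) hab.2.1
  linarith

end IsMasterSolutionG

namespace IsTransitionFamilyG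

variable {P : S × G → ℝ → S × G → ℝ}

open Classical in
open Classical in
open Classical in
theorem apply_zero (hP : IsTransitionFamilyG q σ P) (x z : S × G) :
    P x 0 z = if z = x then 1 else 0 := by
  split_ifs with h
  · rw [h]; exact (hP.2.1 x).1
  · exact (hP.2.1 x).2 z h

theorem nonneg (hP : IsTransitionFamilyG q σ P) (x : S × G) {t : ℝ} (ht : 0 ≤ t) (z : S × G) :
    0 ≤ P x t z := ((hP.1 x).1 t ht).1 z

theorem exp_le_self (hP : IsTransitionFamilyG q σ P) (hq : ∀ i j : S, i ≠ j → 0 ≤ q i j)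
    (x : S × G) {t : ℝ} (ht : 0 ≤ t) : Real.exp (-(rateBound q * t)) ≤ P x t x := by
  have h := (hP.1 x).monotoneOn_exp_mul hq x (Set.mem_Ici.2 le_rfl) ht ht
  simp only [mul_zero, Real.exp_zero, one_mul, (hP.2.1 x).1] at h
  rw [Real.exp_neg, inv_le_iff_one_le_mul₀ (Real.exp_pos _)]
  linarith

theorem pos (hP : IsTransitionFamilyG q σ P) (hq : ∀ i j : S, i ≠ j → 0 ≤ q i j)
    (hσ : ∀ i j, σ j i = (σ i j)⁻¹) {x y : S × G}
    (hxy : Relation.ReflTransGen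
        (fun a b : S × G => a.1 ≠ b.1 ∧ 0 < q a.1 b.1 ∧ b.2 = a.2 * σ a.1 b.1) x y) :
    ∀ t, 0 < t → 0 < P x t y := by
  induction hxy with
  | refl => exact fun t ht => (Real.exp_pos _).trans_le (hP.exp_le_self hq x ht.le)
  | tail _ hbc ih => exact (hP.1 x).pos_of_edge hq hσ hbc ih

theorem translate (hP : IsTransitionFamilyG q σ P) (g : G) (k : S) (z : S × G) {t : ℝ}
    (ht : 0 ≤ t) : P (k, g) t z = P (k, 1) t (z.1, g⁻¹ * z.2) := by
  refine (hP.1 (k, g)).unique ((hP.1 (k, 1)).translate g⁻¹) (funext fun w => ?_) ht z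
  obtain ⟨i, a⟩ := w
  have : (i, a) = (k, g) ↔ (i, g⁻¹ * a) = (k, 1) := by
    simp only [Prod.mk.injEq, inv_mul_eq_one, eq_comm]
  rw [hP.apply_zero, hP.apply_zero]
  split_ifs <;> tauto

theorem hasSum_chapman_kolmogorov (hP : IsTransitionFamilyG q σ P) (x z : S × G) {s t : ℝ}
    (hs : 0 ≤ s) (ht : 0 ≤ t) : HasSum (fun y => P x s y * P y t z) (P x (s + t) z) := by
  rw [hP.2.2 x z s t hs ht]
  refine (Summable.of_nonneg_of_le (fun y => mul_nonneg (hP.nonneg x hs y) (hP.nonneg y ht z))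
    (fun y => ?_) ((hP.1 x).hasSum hs).summable).hasSum
  exact mul_le_of_le_one_right (hP.nonneg x hs y) ((hP.1 y).le_one ht z)

end IsTransitionFamilyG

end Lift

theorem MI_eq_sub {Y Z : Type*} {ν : Y → ℝ} {K : Y → Z → ℝ} {p : Z → ℝ} {H H' : ℝ}
    (hν0 : ∀ y, 0 ≤ ν y) (hK0 : ∀ y z, 0 ≤ K y z) (hK : ∀ y, HasSum (K y) 1)
    (hp1 : ∀ z, p z ≤ 1) (hp : ∀ z, HasSum (fun y => ν y * K y z) (p z))
    (hH0 : 0 ≤ H) (hH'0 : 0 ≤ H') (hH : entropyENN p = ENNReal.ofReal H)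
    (hH' : ∑' y, ENNReal.ofReal (ν y) * entropyENN (K y) = ENNReal.ofReal H') :
    MI (fun yz : Y × Z => ν yz.1 * K yz.1 yz.2) = H - H' := by
  have hp0 : ∀ z, 0 ≤ p z := fun z => (hp z).nonneg fun y => mul_nonneg (hν0 y) (hK0 y z)
  have hK1 : ∀ y z, K y z ≤ 1 := fun y z => le_hasSum (hK y) z fun i _ => hK0 y i
  have ep := fun z => (hp z).tsum_ofReal (fun y => mul_nonneg (hν0 y) (hK0 y z))
  have h1 : HasSum (fun yz : Y × Z => ν yz.1 * K yz.1 yz.2 * -Real.log (p yz.2)) H := by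
    refine hasSum_of_tsum_ofReal (fun yz => mul_nonneg (mul_nonneg (hν0 _) (hK0 _ _))
      (neg_nonneg.2 (Real.log_nonpos (hp0 _) (hp1 _)))) hH0 ?_
    rw [ENNReal.tsum_prod', ENNReal.tsum_comm, ← hH]
    refine tsum_congr fun z => ?_
    rw [ofReal_negMulLog (hp0 z), ← ep, ← ENNReal.tsum_mul_right]
    exact tsum_congr fun y => ENNReal.ofReal_mul (mul_nonneg (hν0 y) (hK0 y z))
  have h2 : HasSum (fun yz : Y × Z => ν yz.1 * Real.negMulLog (K yz.1 yz.2)) H' := by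
    refine hasSum_of_tsum_ofReal (fun yz => mul_nonneg (hν0 _)
      (Real.negMulLog_nonneg (hK0 _ _) (hK1 _ _))) hH'0 ?_
    rw [ENNReal.tsum_prod', ← hH']
    refine tsum_congr fun y => ?_
    rw [entropyENN, ← ENNReal.tsum_mul_left]
    exact tsum_congr fun z => ENNReal.ofReal_mul (hν0 y)
  rw [← (h1.sub h2).tsum_eq, MI]
  refine tsum_congr fun yz => ?_
  obtain ⟨y, z⟩ := yz
  dsimp only
  rw [((hK y).mul_left (ν y)).tsum_eq, (hp z).tsum_eq, mul_one, Real.negMulLog]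
  rcases (hν0 y).eq_or_lt with h | hy
  · simp [← h]
  rcases (hK0 y z).eq_or_lt with h | hz
  · simp [← h]
  have hpz : 0 < p z := (mul_pos hy hz).trans_le
    (le_hasSum (hp z) y fun i _ => mul_nonneg (hν0 i) (hK0 i z))
  rw [mul_div_mul_left _ _ hy.ne', Real.log_div hz.ne' hpz.ne']
  ring

/-- The transition probabilities of the folded chain on `S`. -/
def folded {S G : Type} [Group G] (P : S × G → ℝ → S × G → ℝ) (s : ℝ) (j k : S) : ℝ :=
  ∑' g, P (j, 1) s (k, g)

namespace IsTransitionFamilyG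

variable {S : Type} [Fintype S] [DecidableEq S] {G : Type} [Group G]
  {q : S → S → ℝ} {σ : S → S → G} {P : S × G → ℝ → S × G → ℝ}

theorem hasSum_folded (hP : IsTransitionFamilyG q σ P) {s : ℝ} (hs : 0 ≤ s) (j k : S) :
    HasSum (fun g => P (j, 1) s (k, g)) (folded P s j k) :=
  (((hP.1 (j, 1)).hasSum hs).summable.comp_injective (Prod.mk_right_injective k)).hasSum

theorem tsum_ofReal_folded (hP : IsTransitionFamilyG q σ P) {s : ℝ} (hs : 0 ≤ s) (j k : S) :
    ∑' g, ENNReal.ofReal (P (j, 1) s (k, g)) = ENNReal.ofReal (folded P s j k) :=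
  (hP.hasSum_folded hs j k).tsum_ofReal fun _ => hP.nonneg _ hs _

theorem folded_nonneg (hP : IsTransitionFamilyG q σ P) {s : ℝ} (hs : 0 ≤ s) (j k : S) :
    0 ≤ folded P s j k := tsum_nonneg fun _ => hP.nonneg _ hs _

theorem le_folded (hP : IsTransitionFamilyG q σ P) {s : ℝ} (hs : 0 ≤ s) (j k : S) (g : G) :
    P (j, 1) s (k, g) ≤ folded P s j k :=
  le_hasSum (hP.hasSum_folded hs j k) g fun _ _ => hP.nonneg _ hs _

theorem sum_folded (hP : IsTransitionFamilyG q σ P) {s : ℝ} (hs : 0 ≤ s) (j : S) :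
    ∑ k, folded P s j k = 1 :=
  (hasSum_fintype _).unique
    (((hP.1 (j, 1)).hasSum hs).prod_fiberwise fun k => hP.hasSum_folded hs j k)

theorem tsum_translate (hP : IsTransitionFamilyG q σ P) (F : ℝ → ENNReal) {t : ℝ} (ht : 0 ≤ t)
    (y : S × G) (k : S) : ∑' g, F (P y t (k, g)) = ∑' g, F (P (y.1, 1) t (k, g)) := by
  rw [← (Equiv.mulLeft y.2⁻¹).tsum_eq fun g => F (P (y.1, 1) t (k, g))]
  exact tsum_congr fun g => congrArg F (hP.translate y.2 y.1 (k, g) ht)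

theorem entropyENN_translate (hP : IsTransitionFamilyG q σ P) {t : ℝ} (ht : 0 ≤ t)
    (y : S × G) : entropyENN (P y t) = entropyENN (P (y.1, 1) t) := by
  simp only [entropyENN, ENNReal.tsum_prod']
  exact tsum_congr fun k => hP.tsum_translate (fun r => ENNReal.ofReal (Real.negMulLog r)) ht y k

theorem tsum_mul_fst (hP : IsTransitionFamilyG q σ P) {s : ℝ} (hs : 0 ≤ s) (j : S)
    (F : S → ENNReal) : ∑' y : S × G, ENNReal.ofReal (P (j, 1) s y) * F y.1 =
      ∑ k, ENNReal.ofReal (folded P s j k) * F k := by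
  rw [ENNReal.tsum_prod', tsum_fintype]
  exact Finset.sum_congr rfl fun k _ => by
    dsimp only
    rw [ENNReal.tsum_mul_right, hP.tsum_ofReal_folded hs]

theorem folded_add (hP : IsTransitionFamilyG q σ P) {s t : ℝ} (hs : 0 ≤ s) (ht : 0 ≤ t)
    (i k : S) : folded P (s + t) i k = ∑ l, folded P s i l * folded P t l k := by
  have hnn : ∀ l ∈ Finset.univ, 0 ≤ folded P s i l * folded P t l k := fun l _ =>
    mul_nonneg (hP.folded_nonneg hs i l) (hP.folded_nonneg ht l k)
  rw [← ENNReal.ofReal_eq_ofReal_iff (hP.folded_nonneg (add_nonneg hs ht) i k)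
    (Finset.sum_nonneg hnn), ← hP.tsum_ofReal_folded (add_nonneg hs ht),
    ENNReal.ofReal_sum_of_nonneg hnn]
  calc ∑' g, ENNReal.ofReal (P (i, 1) (s + t) (k, g))
      = ∑' g, ∑' y, ENNReal.ofReal (P (i, 1) s y) * ENNReal.ofReal (P y t (k, g)) := by
        refine tsum_congr fun g => ?_
        rw [← (hP.hasSum_chapman_kolmogorov (i, 1) (k, g) hs ht).tsum_ofReal
          fun y => mul_nonneg (hP.nonneg _ hs _) (hP.nonneg _ ht _)]
        exact tsum_congr fun y => ENNReal.ofReal_mul (hP.nonneg _ hs _)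
    _ = ∑' y : S × G, ENNReal.ofReal (P (i, 1) s y) * ENNReal.ofReal (folded P t y.1 k) := by
        rw [ENNReal.tsum_comm]
        refine tsum_congr fun y => ?_
        rw [ENNReal.tsum_mul_left, hP.tsum_translate ENNReal.ofReal ht,
          hP.tsum_ofReal_folded ht]
    _ = _ := by
        rw [hP.tsum_mul_fst hs i fun l => ENNReal.ofReal (folded P t l k)]
        exact Finset.sum_congr rfl fun l _ => (ENNReal.ofReal_mul (hP.folded_nonneg hs i l)).symm

section Entropy

variable (hP : IsTransitionFamilyG q σ P)
  (hH : ∀ i : S, ∀ t : ℝ, 0 ≤ t → Summable fun z => Real.negMulLog (P (i, (1 : G)) t z))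

include hP

theorem Hent_nonneg {t : ℝ} (ht : 0 ≤ t) (x : S × G) : 0 ≤ Hent (P x t) :=
  tsum_nonneg fun z => Real.negMulLog_nonneg (hP.nonneg x ht z) ((hP.1 x).le_one ht z)

theorem Hent_zero (x : S × G) : Hent (P x 0) = 0 := by
  have : ∀ z, Real.negMulLog (P x 0 z) = 0 := fun z => by
    rw [hP.apply_zero]
    split_ifs <;> simp
  simp [Hent, this]

theorem sum_folded_mul_Hent_nonneg {s t : ℝ} (hs : 0 ≤ s) (ht : 0 ≤ t) (j : S) :
    0 ≤ ∑ k, folded P s j k * Hent (P (k, (1 : G)) t) :=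
  Finset.sum_nonneg fun k _ => mul_nonneg (hP.folded_nonneg hs j k) (hP.Hent_nonneg ht _)

include hH

theorem entropyENN_eq {t : ℝ} (ht : 0 ≤ t) (i : S) :
    entropyENN (P (i, 1) t) = ENNReal.ofReal (Hent (P (i, (1 : G)) t)) :=
  (hH i t ht).hasSum.tsum_ofReal fun z =>
    Real.negMulLog_nonneg (hP.nonneg _ ht z) ((hP.1 _).le_one ht z)

theorem tsum_mul_entropyENN {s t : ℝ} (hs : 0 ≤ s) (ht : 0 ≤ t) (j : S) :
    ∑' y, ENNReal.ofReal (P (j, 1) s y) * entropyENN (P y t) =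
      ENNReal.ofReal (∑ k, folded P s j k * Hent (P (k, (1 : G)) t)) := by
  simp only [hP.entropyENN_translate ht]
  rw [hP.tsum_mul_fst hs j fun k => entropyENN (P (k, 1) t), ENNReal.ofReal_sum_of_nonneg
    fun k _ => mul_nonneg (hP.folded_nonneg hs j k) (hP.Hent_nonneg ht _)]
  exact Finset.sum_congr rfl fun k _ => by
    rw [hP.entropyENN_eq hH ht, ENNReal.ofReal_mul (hP.folded_nonneg hs j k)]

theorem entropy_defect_nonneg {s t : ℝ} (hs : 0 ≤ s) (hst : s ≤ t) (j : S) :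
    0 ≤ Hent (P (j, (1 : G)) t) - ∑ k, folded P s j k * Hent (P (k, (1 : G)) (t - s)) := by
  have hts : 0 ≤ t - s := sub_nonneg.2 hst
  have h := entropyENN_submodular (Z := Unit) (ν := P (j, 1) s) (K := fun y => P y (t - s))
    (L := fun _ _ => 1) (p := P (j, 1) t) (K' := fun _ _ => 1) (p' := fun _ => 1)
    (fun x => hP.nonneg _ hs x) (fun x y => hP.nonneg x hts y) (fun _ _ => zero_le_one)
    ((hP.1 _).hasSum hs) (fun x => (hP.1 x).hasSum hts) (fun _ => hasSum_unique _)
    (fun z => by simpa using hP.hasSum_chapman_kolmogorov (j, 1) z hs hts)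
    (fun x _ => by simpa using (hP.1 x).hasSum hts)
    (fun _ => by simpa using (hP.1 (j, 1)).hasSum hs)
  have h0 : entropyENN (fun _ : Unit => (1 : ℝ)) = 0 := by simp [entropyENN]
  rw [hP.tsum_mul_entropyENN hH hs hts, hP.entropyENN_eq hH (hs.trans hst), h0] at h
  simp only [mul_zero, tsum_zero, add_zero] at h
  exact sub_nonneg.2 ((ENNReal.ofReal_le_ofReal_iff (hP.Hent_nonneg (hs.trans hst) _)).1 h)

theorem entropy_defect_anti {s t t' : ℝ} (hs : 0 ≤ s) (hst : s ≤ t) (htt' : t ≤ t') (j : S) :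
    Hent (P (j, (1 : G)) t') - ∑ k, folded P s j k * Hent (P (k, (1 : G)) (t' - s)) ≤
      Hent (P (j, (1 : G)) t) - ∑ k, folded P s j k * Hent (P (k, (1 : G)) (t - s)) := by
  have h1 : 0 ≤ t - s := sub_nonneg.2 hst
  have h2 : 0 ≤ t' - t := sub_nonneg.2 htt'
  have h3 : 0 ≤ t' - s := by linarith
  have h4 : 0 ≤ t := hs.trans hst
  have h5 : 0 ≤ t' := h4.trans htt'
  have h := entropyENN_submodular (ν := P (j, 1) s) (K := fun y => P y (t - s))
    (L := fun y => P y (t' - t)) (p := P (j, 1) t) (K' := fun y => P y (t' - s))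
    (p' := P (j, 1) t')
    (fun x => hP.nonneg _ hs x) (fun x y => hP.nonneg x h1 y) (fun x y => hP.nonneg x h2 y)
    ((hP.1 _).hasSum hs) (fun x => (hP.1 x).hasSum h1) (fun x => (hP.1 x).hasSum h2)
    (fun z => by simpa using hP.hasSum_chapman_kolmogorov (j, 1) z hs h1)
    (fun x z => by simpa using hP.hasSum_chapman_kolmogorov x z h1 h2)
    (fun z => by simpa using hP.hasSum_chapman_kolmogorov (j, 1) z hs h3)
  have n1 := hP.sum_folded_mul_Hent_nonneg hs h1 j
  have n2 := hP.sum_folded_mul_Hent_nonneg hs h3 j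
  rw [hP.tsum_mul_entropyENN hH hs h1, hP.tsum_mul_entropyENN hH hs h3,
    hP.entropyENN_eq hH h4, hP.entropyENN_eq hH h5,
    ← ENNReal.ofReal_add n1 (hP.Hent_nonneg h5 _), ← ENNReal.ofReal_add (hP.Hent_nonneg h4 _) n2,
    ENNReal.ofReal_le_ofReal_iff (add_nonneg (hP.Hent_nonneg h4 _) n2)] at h
  linarith

theorem MI_eq_entropy_defect {s t : ℝ} (hs : 0 ≤ s) (hst : s ≤ t) (j : S) :
    MI (fun yz : (S × G) × (S × G) => P (j, (1 : G)) s yz.1 * P yz.1 (t - s) yz.2) =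
      Hent (P (j, (1 : G)) t) - ∑ k, folded P s j k * Hent (P (k, (1 : G)) (t - s)) := by
  have hts : 0 ≤ t - s := sub_nonneg.2 hst
  have ht : 0 ≤ t := hs.trans hst
  exact MI_eq_sub (ν := P (j, 1) s) (K := fun y => P y (t - s)) (p := P (j, 1) t)
    (fun y => hP.nonneg _ hs y) (fun y z => hP.nonneg y hts z) (fun y => (hP.1 y).hasSum hts)
    (fun z => (hP.1 _).le_one ht z)
    (fun z => by simpa using hP.hasSum_chapman_kolmogorov (j, 1) z hs hts)
    (hP.Hent_nonneg ht _) (hP.sum_folded_mul_Hent_nonneg hs hts j)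
    (hP.entropyENN_eq hH ht j) (hP.tsum_mul_entropyENN hH hs hts j)

end Entropy

end IsTransitionFamilyG

theorem stmt_9 {S : Type} [Fintype S] [DecidableEq S] (hS : 2 ≤ Fintype.card S)
    {G : Type} [Group G] [Countable G]
    (q : S → S → ℝ)
    (hq_nonneg : ∀ i j : S, i ≠ j → 0 ≤ q i j)
    (hq_sym : ∀ i j : S, i ≠ j → (0 < q i j ↔ 0 < q j i))
    (hq_conn : ∀ i j : S, Relation.ReflTransGen (fun a b => a ≠ b ∧ 0 < q a b) i j)
    (πb : S → ℝ) (hπpos : ∀ i, 0 < πb i) (hπsum : ∑ i, πb i = 1)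
    (hπstat : ∀ j : S,
      ∑ i ∈ Finset.univ.erase j, (πb i * q i j - πb j * q j i) = 0)
    (σ : S → S → G) (hσ : ∀ i j, σ j i = (σ i j)⁻¹)
    (P : S × G → ℝ → S × G → ℝ) (hP : IsTransitionFamilyG q σ P)
    -- the support graph of the G-lift is connected:
    (hGconn : ∀ x y : S × G,
      Relation.ReflTransGen
        (fun a b : S × G => a.1 ≠ b.1 ∧ 0 < q a.1 b.1 ∧ b.2 = a.2 * σ a.1 b.1) x y)
    -- H_t^i < ∞ for all i and t ≥ 0:
    (hH : ∀ i : S, ∀ t : ℝ, 0 ≤ t →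
      Summable (fun z => Real.negMulLog (P (i, (1 : G)) t z))) :
    (∀ i : S, ∃ Li : ℝ,
        Tendsto (fun t : ℝ => Hent (P (i, (1 : G)) t) / t) atTop (nhds Li)) ∧
    (∀ j : S, ∃ Mj : ℝ,
        Tendsto
          (fun t : ℝ =>
            MI (fun yz : (S × G) × (S × G) => P (j, (1 : G)) 1 yz.1 * P yz.1 (t - 1) yz.2))
          atTop (nhds Mj)) ∧
    (∀ (i j : S) (Li Mj : ℝ),
        Tendsto (fun t : ℝ => Hent (P (i, (1 : G)) t) / t) atTop (nhds Li) →
        Tendsto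
          (fun t : ℝ =>
            MI (fun yz : (S × G) × (S × G) => P (j, (1 : G)) 1 yz.1 * P yz.1 (t - 1) yz.2))
          atTop (nhds Mj) →
        (0 < Li ↔ 0 < Mj)) := by
  have : Nonempty S := Fintype.card_pos_iff.1 (by omega)
  have hC : 0 ≤ rateBound q := Finset.sum_nonneg fun i _ => Finset.sum_nonneg fun j _ =>
    add_nonneg (abs_nonneg _) (abs_nonneg _)
  obtain ⟨L, M, hL, hM, hLM⟩ := growth_limits (fun t i => Hent (P (i, (1 : G)) t)) (folded P)
    (Real.exp (-rateBound q)) (fun i => hP.Hent_zero _) (fun t i ht => hP.Hent_nonneg ht _)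
    (fun s i k hs => hP.folded_nonneg hs i k)
    (fun s i k hs => (hP.pos hq_nonneg hσ (hGconn (i, 1) (k, 1)) s hs).trans_le
      (hP.le_folded hs.le i k 1))
    (fun s i hs => hP.sum_folded hs i) (fun s t i k hs ht => hP.folded_add hs ht i k)
    (Real.exp_pos _)
    (fun s i hs hs1 => (Real.exp_le_exp.2 (neg_le_neg (mul_le_of_le_one_right hC hs1))).trans
      ((hP.exp_le_self hq_nonneg (i, 1) hs).trans (hP.le_folded hs i i 1)))
    (fun s t i hs hst => hP.entropy_defect_nonneg hH hs hst i)
    (fun s t t' i hs hst htt' => hP.entropy_defect_anti hH hs hst htt' i)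
  have hMI : ∀ j, Tendsto (fun t : ℝ =>
      MI (fun yz : (S × G) × (S × G) => P (j, (1 : G)) 1 yz.1 * P yz.1 (t - 1) yz.2))
      atTop (nhds (M j)) := fun j => (hM j).congr' <| by
    filter_upwards [eventually_ge_atTop 1] with t ht
    exact (hP.MI_eq_entropy_defect hH zero_le_one ht j).symm
  refine ⟨fun i => ⟨L, hL i⟩, fun j => ⟨M j, hMI j⟩, fun i j Li Mj hLi hMj => ?_⟩
  rw [tendsto_nhds_unique hLi (hL i), tendsto_nhds_unique hMj (hMI j)]
  exact hLM j

end
end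

section
/- Let X and I be countable sets, let (μ_i)_{i∈I} be probability distributions on X, and let (p_i)_{i∈I} be reals with p_i > 0 for all i and Σ_i p_i = 1. Let A ⊆ I be a finite nonempty subset and p_A = Σ_{i∈A} p_i. Assume H[Σ_i p_i μ_i] < ∞, Σ_i p_i·H[μ_i] < ∞, and Σ_{i∉A} (−p_i·log p_i) < ∞. Then H[Σ_i p_i μ_i] − Σ_i p_i·H[μ_i] ≤ p_A·( H[Σ_{i∈A} (p_i/p_A)·μ_i] − Σ_{i∈A} (p_i/p_A)·H[μ_i] ) − p_A·log p_A + Σ_{i∉A} (−p_i·log p_i). -/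
noncomputable section

namespace Real

lemma negMulLog_add_le {a b : ℝ} (ha : 0 ≤ a) (hb : 0 ≤ b) :
    negMulLog (a + b) ≤ negMulLog a + negMulLog b := by
  rcases ha.eq_or_lt with rfl | ha
  · simp
  rcases hb.eq_or_lt with rfl | hb
  · simp
  have h1 : log a ≤ log (a + b) := log_le_log ha (by linarith)
  have h2 : log b ≤ log (a + b) := log_le_log hb (by linarith)
  simp only [negMulLog]
  nlinarith [mul_le_mul_of_nonneg_left h1 ha.le, mul_le_mul_of_nonneg_left h2 hb.le]

lemma negMulLog_sum_le {ι : Type*} (s : Finset ι) {f : ι → ℝ} (hf : ∀ i, 0 ≤ f i) :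
    negMulLog (∑ i ∈ s, f i) ≤ ∑ i ∈ s, negMulLog (f i) := by
  classical
  induction s using Finset.induction_on with
  | empty => simp
  | insert i s hi ih =>
    rw [Finset.sum_insert hi, Finset.sum_insert hi]
    linarith [negMulLog_add_le (hf i) (Finset.sum_nonneg fun j (_ : j ∈ s) => hf j)]

lemma negMulLog_tsum_le {ι : Type*} {f : ι → ℝ} (hf : ∀ i, 0 ≤ f i) (hs : Summable f)
    (hη : Summable fun i => negMulLog (f i)) :
    negMulLog (∑' i, f i) ≤ ∑' i, negMulLog (f i) :=
  le_of_tendsto_of_tendsto' ((continuous_negMulLog.tendsto _).comp hs.hasSum) hη.hasSum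
    fun s => negMulLog_sum_le s hf

lemma hasSum_negMulLog_const_mul {X : Type*} {r : X → ℝ} (c : ℝ) (hr : HasSum r 1)
    (hη : Summable fun x => negMulLog (r x)) :
    HasSum (fun x => negMulLog (c * r x)) (c * Hent r + negMulLog c) := by
  have h := (hη.hasSum.mul_left c).add (hr.mul_right (negMulLog c))
  rw [one_mul] at h
  refine h.congr_fun ?_
  intro x
  rw [negMulLog_mul]
  ring

end Real

open Real in
theorem stmt_13 {I X : Type} [Countable I] [Countable X]
    (μ : I → X → ℝ) (hμ : ∀ i, (∀ x, 0 ≤ μ i x) ∧ (∑' x, μ i x) = 1)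
    (p : I → ℝ) (hp : ∀ i, 0 < p i) (hp1 : (∑' i, p i) = 1)
    (A : Finset I) (hA : A.Nonempty)
    (pA : ℝ) (hpA : pA = ∑ i ∈ A, p i)
    -- H[Σ p_i μ_i] < ∞:
    (hmix : Summable (fun x => Real.negMulLog (∑' i, p i * μ i x)))
    -- Σ p_i·H[μ_i] < ∞:
    (hHμ : ∀ i, Summable (fun x => Real.negMulLog (μ i x)))
    (hsum : Summable (fun i => p i * Hent (μ i)))
    -- Σ_{i∉A} (−p_i·log p_i) < ∞:
    (htail : Summable (fun i : {j : I // j ∉ A} => Real.negMulLog (p (i : I)))) :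
    Hent (fun x => ∑' i, p i * μ i x) - (∑' i, p i * Hent (μ i))
      ≤ pA * (Hent (fun x => ∑ i ∈ A, (p i / pA) * μ i x)
              - ∑ i ∈ A, (p i / pA) * Hent (μ i))
        - pA * Real.log pA
        + ∑' i : {j : I // j ∉ A}, Real.negMulLog (p (i : I)) := by
  have hμ0 : ∀ i x, 0 ≤ μ i x := fun i => (hμ i).1
  have hμs : ∀ i, HasSum (μ i) 1 := fun i => by
    have h : Summable (μ i) := by
      by_contra h
      have := (hμ i).2
      rw [tsum_eq_zero_of_not_summable h] at this
      norm_num at this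
    exact (hμ i).2 ▸ h.hasSum
  have hμ1 : ∀ i x, μ i x ≤ 1 := fun i x => le_hasSum (hμs i) x fun y _ => hμ0 i y
  have hps : HasSum p 1 := by
    have h : Summable p := by
      by_contra h
      rw [tsum_eq_zero_of_not_summable h] at hp1
      norm_num at hp1
    exact hp1 ▸ h.hasSum
  have hple : ∀ i, p i ≤ 1 := fun i => le_hasSum hps i fun j _ => (hp j).le
  have hpA0 : 0 < pA := hpA ▸ Finset.sum_pos (fun i _ => hp i) hA
  have hpμ0 : ∀ i x, 0 ≤ p i * μ i x := fun i x => mul_nonneg (hp i).le (hμ0 i x)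
  have hη0 : ∀ i x, 0 ≤ negMulLog (p i * μ i x) := fun i x =>
    negMulLog_nonneg (hpμ0 i x) (mul_le_one₀ (hple i) (hμ0 i x) (hμ1 i x))
  have hη : ∀ i, HasSum (fun x => negMulLog (p i * μ i x)) (p i * Hent (μ i) + negMulLog (p i)) :=
    fun i => hasSum_negMulLog_const_mul (p i) (hμs i) (hHμ i)
  have hpμs : ∀ x, Summable fun i => p i * μ i x := fun x =>
    hps.summable.of_nonneg_of_le (fun i => hpμ0 i x)
      fun i => mul_le_of_le_one_right (hp i).le (hμ1 i x)
  -- The part of the mixture indexed by `A`, normalized.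
  set b : X → ℝ := fun x => ∑ i ∈ A, (p i / pA) * μ i x with hb_def
  have hpAb : ∀ x, pA * b x = ∑ i ∈ A, p i * μ i x := fun x => by
    rw [hb_def, Finset.mul_sum]
    exact Finset.sum_congr rfl fun i _ => by field_simp
  have hb1 : HasSum b 1 := by
    have h := hasSum_sum fun i (_ : i ∈ A) => (hμs i).mul_left (p i / pA)
    rwa [← Finset.sum_mul, ← Finset.sum_div, ← hpA, div_self hpA0.ne', mul_one] at h
  have hb0 : ∀ x, 0 ≤ b x := fun x =>
    Finset.sum_nonneg fun i _ => mul_nonneg (div_pos (hp i) hpA0).le (hμ0 i x)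
  have hbη : Summable fun x => negMulLog (b x) := by
    refine (hasSum_sum fun i (_ : i ∈ A) => hasSum_negMulLog_const_mul (p i / pA) (hμs i)
      (hHμ i)).summable.of_nonneg_of_le (fun x => negMulLog_nonneg (hb0 x) ?_) fun x => ?_
    · exact le_hasSum hb1 x fun y _ => hb0 y
    · exact negMulLog_sum_le A fun i => mul_nonneg (div_pos (hp i) hpA0).le (hμ0 i x)
  have hbsum := hasSum_negMulLog_const_mul pA hb1 hbη
  -- The tail, indexed by the complement of `A`.
  have hprod : Summable fun q : {j : I // j ∉ A} × X => negMulLog (p q.1 * μ q.1 q.2) := by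
    refine (summable_prod_of_nonneg fun q => hη0 _ _).2 ⟨fun i => (hη i).summable, ?_⟩
    simp only [(hη _).tsum_eq]
    exact (hsum.subtype _).add htail
  have htailx : ∀ x, Summable fun i : {j : I // j ∉ A} => negMulLog (p i * μ i x) :=
    fun x => hprod.prod_symm.prod_factor x
  have htailsum : HasSum (fun x => ∑' i : {j : I // j ∉ A}, negMulLog (p i * μ i x))
      (∑' i : {j : I // j ∉ A}, p i * Hent (μ i) + ∑' i : {j : I // j ∉ A}, negMulLog (p i)) := by
    have htailH : Summable fun i : {j : I // j ∉ A} => p i * Hent (μ i) := hsum.subtype _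
    rw [← htailH.tsum_add htail]
    have h := hprod.prod_symm.prod.hasSum
    have hcomm := Summable.tsum_comm
      (f := fun (i : {j : I // j ∉ A}) (x : X) => negMulLog (p i * μ i x)) hprod
    simp only [(hη _).tsum_eq] at hcomm
    rw [← hcomm]
    exact h
  have key : ∀ x, negMulLog (∑' i, p i * μ i x) ≤
      negMulLog (pA * b x) + ∑' i : {j : I // j ∉ A}, negMulLog (p i * μ i x) := fun x => by
    rw [← (hpμs x).sum_add_tsum_subtype_compl A, hpAb]
    refine (negMulLog_add_le (Finset.sum_nonneg fun i _ => hpμ0 i x)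
      (tsum_nonneg fun i => hpμ0 _ x)).trans ?_
    gcongr
    exact negMulLog_tsum_le (fun i => hpμ0 _ x) ((hpμs x).subtype _) (htailx x)
  have hle := hasSum_le key hmix.hasSum (hbsum.add htailsum)
  have hsplit := hsum.sum_add_tsum_subtype_compl A
  have hscale : pA * ∑ i ∈ A, (p i / pA) * Hent (μ i) = ∑ i ∈ A, p i * Hent (μ i) := by
    rw [Finset.mul_sum]
    exact Finset.sum_congr rfl fun i _ => by field_simp
  rw [mul_sub, hscale, ← hsplit]
  have hneg : negMulLog pA = -(pA * log pA) := by simp [negMulLog]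
  rw [hneg] at hle
  change Hent _ ≤ _ at hle
  linarith

end
end

section
/- Let X be a countable set, k ≥ 1, and let μ_1, …, μ_k be probability distributions on X with H[μ_i] < ∞ for each i. Let (q_i) and (q'_i) be probability vectors on {1,…,k} with q'_i > 0 for all i, and let C₄ = max_{1≤i≤k} q_i/q'_i. Then H[Σ_{i=1}^k q_i μ_i] − Σ_{i=1}^k q_i·H[μ_i] ≤ C₄·( H[Σ_{i=1}^k q'_i μ_i] − Σ_{i=1}^k q'_i·H[μ_i] ). -/
noncomputable section

/-- `Real.negMulLog` is subadditive on nonnegative reals. -/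
theorem negMulLog_sum_le {ι : Type*} (s : Finset ι) (a : ι → ℝ) (ha : ∀ i ∈ s, 0 ≤ a i) :
    Real.negMulLog (∑ i ∈ s, a i) ≤ ∑ i ∈ s, Real.negMulLog (a i) := by
  rw [Real.negMulLog, neg_mul, Finset.sum_mul, ← Finset.sum_neg_distrib]
  refine Finset.sum_le_sum fun i hi => ?_
  rw [Real.negMulLog, neg_mul, neg_le_neg_iff]
  rcases (ha i hi).eq_or_lt with h | h
  · simp [← h]
  · exact mul_le_mul_of_nonneg_left
      (Real.log_le_log h (Finset.single_le_sum (f := a) ha hi)) h.le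

/-- A finite mixture of distributions of finite entropy has finite entropy. -/
theorem summable_negMulLog_mixture {X ι : Type*} [Fintype ι] {μ : ι → X → ℝ}
    (hμ0 : ∀ i x, 0 ≤ μ i x) (hμ1 : ∀ i x, μ i x ≤ 1) (hμ : ∀ i, Summable (μ i))
    (hHμ : ∀ i, Summable fun x => Real.negMulLog (μ i x))
    {w : ι → ℝ} (hw : ∀ i, 0 ≤ w i) (hw1 : ∑ i, w i = 1) :
    Summable fun x => Real.negMulLog (∑ i, w i * μ i x) := by
  have hsum : Summable fun x => ∑ i, Real.negMulLog (w i * μ i x) := by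
    refine summable_sum fun i _ => ?_
    simp_rw [Real.negMulLog_mul]
    exact ((hμ i).mul_right _).add ((hHμ i).mul_left _)
  refine Summable.of_nonneg_of_le (fun x => ?_) (fun x => ?_) hsum
  · refine Real.negMulLog_nonneg
      (Finset.sum_nonneg fun i _ => mul_nonneg (hw i) (hμ0 i x)) ?_
    rw [← hw1]
    exact Finset.sum_le_sum fun i _ => mul_le_of_le_one_right (hw i) (hμ1 i x)
  · exact negMulLog_sum_le _ _ fun i _ => mul_nonneg (hw i) (hμ0 i x)

/-- If `w ≤ C • w'` for weight vectors `w`, `w'` of total mass one, then Jensen's inequality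
for the remaining weights `C • w' - w` compares the two mixtures. -/
theorem negMulLog_mixture_add_le {ι : Type*} [Fintype ι] {a w w' : ι → ℝ} {C : ℝ}
    (ha : ∀ i, 0 ≤ a i) (hw : ∀ i, 0 ≤ w i) (hw1 : ∑ i, w i = 1) (hw'1 : ∑ i, w' i = 1)
    (hC : 0 < C) (hle : ∀ i, w i ≤ C * w' i) :
    Real.negMulLog (∑ i, w i * a i) + ∑ i, (C * w' i - w i) * Real.negMulLog (a i)
      ≤ C * Real.negMulLog (∑ i, w' i * a i) := by
  have jensen := Real.concaveOn_negMulLog.le_map_sum (t := Finset.univ)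
    (w := fun o : Option ι => o.elim C⁻¹ fun i => C⁻¹ * (C * w' i - w i))
    (p := fun o : Option ι => o.elim (∑ i, w i * a i) a)
    (by
      rintro (_ | i) _
      · exact (inv_pos.2 hC).le
      · exact mul_nonneg (inv_pos.2 hC).le (sub_nonneg.2 (hle i)))
    (by
      simp only [Fintype.sum_option, Option.elim, ← Finset.mul_sum, Finset.sum_sub_distrib,
        hw1, hw'1]
      field_simp
      ring)
    (by
      rintro (_ | i) _
      · exact Finset.sum_nonneg fun i _ => mul_nonneg (hw i) (ha i)
      · exact ha i)
  simp only [Fintype.sum_option, Option.elim, smul_eq_mul, mul_assoc, ← Finset.mul_sum,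
    ← mul_add] at jensen
  have hmix : C⁻¹ * (∑ i, w i * a i + ∑ i, (C * w' i - w i) * a i) = ∑ i, w' i * a i := by
    rw [← Finset.sum_add_distrib, Finset.mul_sum]
    refine Finset.sum_congr rfl fun i _ => ?_
    field_simp
    ring
  rwa [hmix, inv_mul_le_iff₀ hC] at jensen

theorem stmt_14 {X : Type} [Countable X] (k : ℕ) (hk : 1 ≤ k)
    (μ : Fin k → X → ℝ) (hμ : ∀ i, (∀ x, 0 ≤ μ i x) ∧ (∑' x, μ i x) = 1)
    -- H[μ_i] < ∞ for each i:
    (hHμ : ∀ i, Summable (fun x => Real.negMulLog (μ i x)))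
    (Q Q' : Fin k → ℝ)
    (hQ : ∀ i, 0 ≤ Q i) (hQ1 : ∑ i, Q i = 1)
    (hQ' : ∀ i, 0 < Q' i) (hQ'1 : ∑ i, Q' i = 1)
    -- C₄ is the maximum of q_i/q'_i:
    (C₄ : ℝ) (hC₄ : IsGreatest (Set.range fun i => Q i / Q' i) C₄) :
    Hent (fun x => ∑ i, Q i * μ i x) - (∑ i, Q i * Hent (μ i))
      ≤ C₄ * (Hent (fun x => ∑ i, Q' i * μ i x) - ∑ i, Q' i * Hent (μ i)) := by
  have hμ0 : ∀ i x, 0 ≤ μ i x := fun i => (hμ i).1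
  have hμs : ∀ i, Summable (μ i) := fun i => by
    by_contra h
    simpa [tsum_eq_zero_of_not_summable h] using (hμ i).2
  have hμ1 : ∀ i x, μ i x ≤ 1 := fun i x =>
    (hμ i).2 ▸ (hμs i).le_tsum x fun y _ => hμ0 i y
  have hle : ∀ i, Q i ≤ C₄ * Q' i := fun i =>
    (div_le_iff₀ (hQ' i)).1 (hC₄.2 ⟨i, rfl⟩)
  have hC : 0 < C₄ := by
    have h : ∑ i, Q i ≤ ∑ i, C₄ * Q' i := Finset.sum_le_sum fun i _ => hle i
    rw [← Finset.mul_sum, hQ1, hQ'1] at h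
    linarith
  have hs := summable_negMulLog_mixture hμ0 hμ1 hμs hHμ hQ hQ1
  have hs' := summable_negMulLog_mixture hμ0 hμ1 hμs hHμ (fun i => (hQ' i).le) hQ'1
  have hr : ∀ i ∈ Finset.univ, Summable fun x => (C₄ * Q' i - Q i) * Real.negMulLog (μ i x) :=
    fun i _ => (hHμ i).mul_left _
  have key := (hs.add (summable_sum hr)).tsum_le_tsum
    (fun x => negMulLog_mixture_add_le (fun i => hμ0 i x) hQ hQ1 hQ'1 hC hle)
    (hs'.mul_left C₄)
  rw [hs.tsum_add (summable_sum hr), Summable.tsum_finsetSum hr, tsum_mul_left] at key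
  simp only [tsum_mul_left] at key
  simp only [sub_mul, Finset.sum_sub_distrib, mul_assoc, ← Finset.mul_sum] at key
  simp only [Hent]
  linarith

end
end

section
/- Let G = (V, E) be a finite connected simple graph, T a spanning tree of G, and let e₁, …, e_n (where n = |E| − |V| + 1) be an enumeration of the edges of G not in T. Fix a linear order on V and define σ : V × V → ℤ^n on adjacent ordered pairs by: σ(u,v) = 0 if {u,v} is an edge of T; σ(u,v) = ε_k (the k-th standard basis vector of ℤ^n) if {u,v} = e_k and u < v; and σ(u,v) = −ε_k if {u,v} = e_k and u > v. Let L be the graph with vertex set V × ℤ^n in which (u,α) is adjacent to (v,β) if and only if {u,v} ∈ E and β = α + σ(u,v). Then for every walk W in L from (u,α) to (v,β): (u,α) = (v,β) if and only if for every ordered pair (x,y) of adjacent vertices of G, the number of steps of the projection of W to G traversing x→y equals the number of steps traversing y→x. -/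
noncomputable section

/-- The number of steps `x → y` among the first `m` steps of the sequence `p`. -/
def stepCount {V : Type} [DecidableEq V] (p : ℕ → V) (m : ℕ) (x y : V) : ℕ :=
  ((Finset.range m).filter fun l => p l = x ∧ p (l + 1) = y).card

/-- The antisymmetric indicator of the ordered pair `(x, y)`. -/
def stepSign {V : Type} [DecidableEq V] (x y a b : V) : ℤ :=
  (if a = x ∧ b = y then 1 else 0) - (if a = y ∧ b = x then 1 else 0)

theorem sum_stepSign {V : Type} [DecidableEq V] (p : ℕ → V) (m : ℕ) (x y : V) :
    ∑ l ∈ Finset.range m, stepSign x y (p l) (p (l + 1)) =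
      (stepCount p m x y : ℤ) - stepCount p m y x := by
  simp [stepSign, stepCount, Finset.sum_sub_distrib, Finset.sum_boole]

theorem stepCount_eq_zero {V : Type} [DecidableEq V] {G : SimpleGraph V} {p : ℕ → V} {m : ℕ}
    (hp : ∀ l < m, G.Adj (p l) (p (l + 1))) {x y : V} (h : ¬ G.Adj x y) :
    stepCount p m x y = 0 := by
  rw [stepCount, Finset.card_eq_zero, Finset.filter_eq_empty_iff]
  rintro l hl ⟨rfl, rfl⟩
  exact h (hp l (Finset.mem_range.mp hl))

theorem sum_steps_eq_sum_stepCount {V : Type} [Fintype V] [DecidableEq V] (p : ℕ → V) (m : ℕ)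
    (g : V → V → ℤ) :
    ∑ l ∈ Finset.range m, g (p l) (p (l + 1)) = ∑ a, ∑ b, (stepCount p m a b : ℤ) * g a b := by
  have h : ∀ l, g (p l) (p (l + 1)) =
      ∑ a, ∑ b, (if p l = a ∧ p (l + 1) = b then 1 else 0) * g a b := by
    intro l
    simp [ite_and]
  rw [Finset.sum_congr rfl fun l _ => h l, Finset.sum_comm]
  refine Finset.sum_congr rfl fun a _ => ?_
  rw [Finset.sum_comm]
  refine Finset.sum_congr rfl fun b _ => ?_
  rw [← Finset.sum_mul, Finset.sum_boole, stepCount]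

/-- Along a walk, an edge function which is antisymmetric, and which vanishes on every edge that
is not traversed equally often in both directions, sums to zero. -/
theorem sum_steps_eq_zero {V : Type} [Fintype V] [DecidableEq V] {G : SimpleGraph V} {p : ℕ → V}
    {m : ℕ} (hp : ∀ l < m, G.Adj (p l) (p (l + 1))) (g : V → V → ℤ)
    (hg : ∀ a b, G.Adj a b → g b a = -g a b)
    (hc : ∀ a b, G.Adj a b → g a b = 0 ∨ stepCount p m a b = stepCount p m b a) :
    ∑ l ∈ Finset.range m, g (p l) (p (l + 1)) = 0 := by
  have key : ∀ a b, (stepCount p m a b : ℤ) * g a b = -((stepCount p m b a : ℤ) * g b a) := by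
    intro a b
    by_cases hab : G.Adj a b
    · rw [hg a b hab]
      rcases hc a b hab with h | h <;> simp [h]
    · rw [stepCount_eq_zero hp hab, stepCount_eq_zero hp fun h => hab h.symm]
      simp
  have hs := sum_steps_eq_sum_stepCount p m g
  have : ∑ a, ∑ b, (stepCount p m a b : ℤ) * g a b =
      -∑ a, ∑ b, (stepCount p m a b : ℤ) * g a b := by
    conv_lhs => rw [Finset.sum_comm]
    simp only [← Finset.sum_neg_distrib]
    exact Finset.sum_congr rfl fun a _ => Finset.sum_congr rfl fun b _ => key b a
  lia

/-- A closed walk crosses an edge of an acyclic subgraph equally often in both directions as soon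
as it does so for all edges outside that subgraph. -/
theorem stepCount_comm_of_isAcyclic {V : Type} [Fintype V] [DecidableEq V] {G T : SimpleGraph V}
    (hT : T.IsAcyclic) {p : ℕ → V} {m : ℕ} (hp : ∀ l < m, G.Adj (p l) (p (l + 1)))
    (hclosed : p 0 = p m)
    (hc : ∀ a b, G.Adj a b → ¬ T.Adj a b → stepCount p m a b = stepCount p m b a)
    {x y : V} (hxy : T.Adj x y) : stepCount p m x y = stepCount p m y x := by
  classical
  have hne := hxy.ne
  have hbridge : ¬ (T.deleteEdges {s(x, y)}).Reachable x y :=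
    SimpleGraph.isBridge_iff.mp (SimpleGraph.isAcyclic_iff_forall_adj_isBridge.mp hT hxy)
  let h : V → ℤ := fun v => if (T.deleteEdges {s(x, y)}).Reachable x v then 1 else 0
  have hx : h x = 1 := if_pos (SimpleGraph.Reachable.refl _)
  have hy : h y = 0 := if_neg hbridge
  have hstep : ∀ a b, T.Adj a b → s(a, b) ≠ s(x, y) → h a = h b := by
    intro a b hab hn
    have hadj : (T.deleteEdges {s(x, y)}).Adj a b := by
      simpa [SimpleGraph.deleteEdges_adj, hab] using hn
    have : (T.deleteEdges {s(x, y)}).Reachable x a ↔ (T.deleteEdges {s(x, y)}).Reachable x b :=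
      ⟨fun r => r.trans hadj.reachable, fun r => r.trans hadj.symm.reachable⟩
    simp only [h, this]
  have hsum := sum_steps_eq_zero hp (fun a b => (h b - h a) + stepSign x y a b)
    (fun a b _ => by simp only [stepSign, and_comm]; ring)
    (fun a b hab => by
      by_cases hTab : T.Adj a b
      · left
        by_cases he : s(a, b) = s(x, y)
        · rcases Sym2.eq_iff.mp he with ⟨rfl, rfl⟩ | ⟨rfl, rfl⟩ <;>
            simp [stepSign, hx, hy, hne, hne.symm]
        · have h1 : ¬ (a = x ∧ b = y) := fun ⟨h1, h2⟩ => he (by rw [h1, h2])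
          have h2 : ¬ (a = y ∧ b = x) := fun ⟨h1, h2⟩ => he (by rw [h1, h2, Sym2.eq_swap])
          simp [stepSign, h1, h2, hstep a b hTab he]
      · exact Or.inr (hc a b hab hTab))
  rw [Finset.sum_add_distrib, Finset.sum_range_sub (fun l => h (p l)), sum_stepSign,
    hclosed] at hsum
  lia

/-- A walk that traverses every edge equally often in both directions is closed. -/
theorem eq_of_stepCount_comm {V : Type} [Fintype V] [DecidableEq V] {G : SimpleGraph V}
    {p : ℕ → V} {m : ℕ} (hp : ∀ l < m, G.Adj (p l) (p (l + 1)))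
    (hc : ∀ a b, G.Adj a b → stepCount p m a b = stepCount p m b a) : p 0 = p m := by
  let h : V → ℤ := fun v => if v = p 0 then 1 else 0
  have hsum := sum_steps_eq_zero hp (fun a b => h b - h a) (fun a b _ => by ring)
    (fun a b hab => Or.inr (hc a b hab))
  rw [Finset.sum_range_sub (fun l => h (p l))] at hsum
  by_contra hne
  simp [h, Ne.symm hne] at hsum

theorem stmt_16 {V : Type} [Fintype V] [DecidableEq V] [LinearOrder V]
    (G T : SimpleGraph V) [DecidableRel G.Adj] [DecidableRel T.Adj]
    (hG : G.Connected) (hT : T.IsTree) (hTG : T ≤ G)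
    {n : ℕ} (hn : n + Fintype.card V = G.edgeFinset.card + 1)
    -- e₁, …, e_n enumerate the edges of G that are not in T:
    (e : Fin n → Sym2 V) (he_inj : Function.Injective e)
    (he_range : Set.range e = G.edgeSet \ T.edgeSet)
    -- σ as defined from the spanning tree, the enumeration, and the linear order:
    (σ : V → V → (Fin n → ℤ))
    (hσT : ∀ u v, T.Adj u v → σ u v = 0)
    (hσe : ∀ (u v : V) (k : Fin n), G.Adj u v → ¬ T.Adj u v → s(u, v) = e k →
      σ u v = if u < v then Pi.single k 1 else -(Pi.single k 1))
    -- W is a walk in the lifted graph L, encoded by its m+1 vertices: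
    (m : ℕ) (w : ℕ → V × (Fin n → ℤ))
    (hw : ∀ l < m, G.Adj (w l).1 (w (l + 1)).1 ∧
      (w (l + 1)).2 = (w l).2 + σ (w l).1 (w (l + 1)).1) :
    -- W is closed iff every ordered pair of adjacent vertices of G is traversed
    -- the same number of times in both directions by the projection of W:
    w 0 = w m ↔
      ∀ x y : V, G.Adj x y →
        ((Finset.range m).filter fun l => (w l).1 = x ∧ (w (l + 1)).1 = y).card =
        ((Finset.range m).filter fun l => (w l).1 = y ∧ (w (l + 1)).1 = x).card := by
  set p : ℕ → V := fun l => (w l).1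
  have hp : ∀ l < m, G.Adj (p l) (p (l + 1)) := fun l hl => (hw l hl).1
  have hvolt : ∀ k, (w m).2 k - (w 0).2 k = ∑ l ∈ Finset.range m, σ (p l) (p (l + 1)) k := by
    intro k
    rw [← Finset.sum_range_sub (fun l => (w l).2 k)]
    refine Finset.sum_congr rfl fun l hl => ?_
    rw [(hw l (Finset.mem_range.mp hl)).2, Pi.add_apply]
    exact add_sub_cancel_left _ _
  have hindex : ∀ a b, G.Adj a b → ¬ T.Adj a b → ∃ k, s(a, b) = e k := by
    intro a b hab hTab
    have : s(a, b) ∈ Set.range e := by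
      rw [he_range]
      exact ⟨hab, hTab⟩
    obtain ⟨k, hk⟩ := this
    exact ⟨k, hk.symm⟩
  have hanti : ∀ a b, G.Adj a b → σ b a = -σ a b := by
    intro a b hab
    by_cases hTab : T.Adj a b
    · rw [hσT a b hTab, hσT b a hTab.symm, neg_zero]
    · obtain ⟨k, hk⟩ := hindex a b hab hTab
      rw [hσe a b k hab hTab hk,
        hσe b a k hab.symm (fun h => hTab h.symm) (Sym2.eq_swap.trans hk)]
      rcases lt_or_gt_of_ne hab.ne with h | h <;> simp [h, h.not_gt]
  change _ ↔ ∀ x y, G.Adj x y → stepCount p m x y = stepCount p m y x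
  constructor
  · intro hclosed
    have hnontree : ∀ x y, G.Adj x y → ¬ T.Adj x y →
        stepCount p m x y = stepCount p m y x := by
      intro x y hxy hTxy
      obtain ⟨k, hk⟩ := hindex x y hxy hTxy
      have h_unit : σ x y k ≠ 0 := by
        rw [hσe x y k hxy hTxy hk]
        split_ifs <;> simp
      have hterm : ∀ a b, G.Adj a b → σ a b k = σ x y k * stepSign x y a b := by
        intro a b hab
        by_cases he : s(a, b) = s(x, y)
        · rcases Sym2.eq_iff.mp he with ⟨rfl, rfl⟩ | ⟨rfl, rfl⟩
          · simp [stepSign, hab.ne]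
          · rw [hanti _ _ hxy]
            simp [stepSign, hab.ne]
        · have h1 : ¬ (a = x ∧ b = y) := fun ⟨h1, h2⟩ => he (by rw [h1, h2])
          have h2 : ¬ (a = y ∧ b = x) := fun ⟨h1, h2⟩ => he (by rw [h1, h2, Sym2.eq_swap])
          have h0 : σ a b k = 0 := by
            by_cases hTab : T.Adj a b
            · rw [hσT a b hTab, Pi.zero_apply]
            · obtain ⟨j, hj⟩ := hindex a b hab hTab
              have hkj : k ≠ j := by
                rintro rfl
                exact he (hj.trans hk.symm)
              rw [hσe a b j hab hTab hj]
              split_ifs <;> simp [hkj]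
          simp [stepSign, h0, h1, h2]
      have hsum := hvolt k
      rw [← hclosed, sub_self, Finset.sum_congr rfl fun l hl =>
        hterm _ _ (hp l (Finset.mem_range.mp hl)), ← Finset.mul_sum, sum_stepSign] at hsum
      have := (mul_eq_zero.mp hsum.symm).resolve_left h_unit
      lia
    intro x y hxy
    by_cases hTxy : T.Adj x y
    · exact stepCount_comm_of_isAcyclic hT.isAcyclic hp (congrArg Prod.fst hclosed) hnontree hTxy
    · exact hnontree x y hxy hTxy
  · intro hc
    refine Prod.ext (eq_of_stepCount_comm hp hc) (funext fun k => ?_)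
    have hsum := sum_steps_eq_zero hp (fun a b => σ a b k)
      (fun a b hab => by simp [hanti a b hab]) (fun a b hab => Or.inr (hc a b hab))
    have := hvolt k
    lia

end
end
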